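/- Let P_ℓ(x,D) = Σ_{j,k} a^ℓ_jk(x)∂²_{jk}, ℓ = 1,2, be uniformly elliptic second-order operators on an open neighborhood of 0 in ℝ³ with coefficients in the Gevrey class G^s. Assume α > 0 satisfies α > (λ₃^ℓ − λ₁^ℓ)/λ₁^ℓ for ℓ = 1,2, where λ₁^ℓ ≤ λ₂^ℓ ≤ λ₃^ℓ are the eigenvalues of (a^ℓ_jk(0)), and that s < 1 + 1/α. Then there exist τ₀ > 0, r₀ > 0 and C > 0 such that for every τ > τ₀, every ℓ ∈ {1,2}, and every smooth V : ℝ³ → ℝ⁷ compactly supported in B(0,r₀)∖{0}: Σ_{j=0}^{2} τ^{3−2j} ∫ e^{2τ|x|^{−α}} |x|^{α} |x|^{2(j−2)(1+α)} |D^j V|² dx ≤ C ∫ e^{2τ|x|^{−α}} |P_ℓ V|² dx. -/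

import Mathlib

open MeasureTheory Metric Finset

noncomputable section

/-- `ℝ³` with the Euclidean norm. -/
abbrev E3 := EuclideanSpace ℝ (Fin 3)
/-- `ℝ⁷` with the Euclidean norm. -/
abbrev E7 := EuclideanSpace ℝ (Fin 7)

/-- The partial derivative `∂_i f`. -/
def pd (i : Fin 3) (f : E3 → ℝ) : E3 → ℝ :=
  fun x => fderiv ℝ f x (EuclideanSpace.single i 1)

/-- The multiindex partial derivative `∂^β f`. -/
def mpd (β : Fin 3 → ℕ) (f : E3 → ℝ) : E3 → ℝ :=
  (pd 0)^[β 0] ((pd 1)^[β 1] ((pd 2)^[β 2] f))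

/-- The length `|β|` of a multiindex. -/
def mdeg (β : Fin 3 → ℕ) : ℕ := β 0 + β 1 + β 2

/-- `f` belongs to the Gevrey class `G^s(Ω)`. -/
def GevreyOn (s : ℝ) (Ω : Set E3) (f : E3 → ℝ) : Prop :=
  ContDiffOn ℝ (⊤ : ℕ∞) f Ω ∧ ∃ c > 0, ∃ A > 0, ∀ β : Fin 3 → ℕ, ∀ x ∈ Ω,
    |mpd β f x| ≤ c * A ^ mdeg β * (Nat.factorial (mdeg β) : ℝ) ^ s

/-- The second-order operator `Σ_{j,k} a_jk(x) ∂²_{jk}` applied to a scalar function. -/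
def op2 (a : Fin 3 → Fin 3 → E3 → ℝ) (f : E3 → ℝ) : E3 → ℝ :=
  fun x => ∑ j, ∑ k, a j k x * pd j (pd k f) x

/-- Uniform (strong) ellipticity of `Σ_{j,k} a_jk(x) ∂²_{jk}` on `Ω`. -/
def UnifElliptic (a : Fin 3 → Fin 3 → E3 → ℝ) (Ω : Set E3) : Prop :=
  ∃ c0 > 0, ∀ x ∈ Ω, ∀ ξ : Fin 3 → ℝ,
    c0 * (∑ i, ξ i ^ 2) ≤ ∑ j, ∑ k, a j k x * ξ j * ξ k

/-- The coefficient matrix of the operator at a point. -/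
def coefMatrix (a : Fin 3 → Fin 3 → E3 → ℝ) (x : E3) : Matrix (Fin 3) (Fin 3) ℝ :=
  Matrix.of fun j k => a j k x

/-- `α > (λ₃ - λ₁)/λ₁` where `λ₁ ≤ λ₂ ≤ λ₃` are the eigenvalues of the coefficient
matrix at `0`: equivalently (the eigenvalues being positive), for any pair of
eigenvalues the corresponding ratio is `< α`. -/
def EigCond (a : Fin 3 → Fin 3 → E3 → ℝ) (α : ℝ) : Prop :=
  ∀ h : (coefMatrix a 0).IsHermitian, ∀ i j : Fin 3,
    (h.eigenvalues i - h.eigenvalues j) / h.eigenvalues j < α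

/-- The coefficients `a¹_jk = μ δ_jk + t_jk` of `P₁`. -/
def a1coef (t : Fin 3 → Fin 3 → E3 → ℝ) (mu : E3 → ℝ) : Fin 3 → Fin 3 → E3 → ℝ :=
  fun j k x => mu x * (if j = k then 1 else 0) + t j k x

/-- The coefficients `a²_jk = (λ + 2μ) δ_jk + t_jk` of `P₂`. -/
def a2coef (t : Fin 3 → Fin 3 → E3 → ℝ) (lam mu : E3 → ℝ) : Fin 3 → Fin 3 → E3 → ℝ :=
  fun j k x => (lam x + 2 * mu x) * (if j = k then 1 else 0) + t j k x

/-- The divergence `∇·u`. -/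
def divg (u : E3 → Fin 3 → ℝ) (x : E3) : ℝ := ∑ i, pd i (fun y => u y i) x

/-- The curl `∇×u`. -/
def curl (u : E3 → Fin 3 → ℝ) (x : E3) : Fin 3 → ℝ :=
  ![pd 1 (fun y => u y 2) x - pd 2 (fun y => u y 1) x,
    pd 2 (fun y => u y 0) x - pd 0 (fun y => u y 2) x,
    pd 0 (fun y => u y 1) x - pd 1 (fun y => u y 0) x]

/-- The infinitesimal strain `E = (∇u + (∇u)ᵗ)/2`. -/
def strain (u : E3 → Fin 3 → ℝ) (x : E3) (i j : Fin 3) : ℝ :=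
  (pd j (fun y => u y i) x + pd i (fun y => u y j) x) / 2

/-- The stress tensor `σ = T + (∇u)T + λ(tr E)I + 2μE`. -/
def stress (t : Fin 3 → Fin 3 → E3 → ℝ) (lam mu : E3 → ℝ) (u : E3 → Fin 3 → ℝ)
    (x : E3) (i j : Fin 3) : ℝ :=
  t i j x + (∑ k, pd k (fun y => u y i) x * t k j x)
    + lam x * divg u x * (if i = j then 1 else 0)
    + 2 * mu x * strain u x i j

/-- The residual stress system `∇·σ + κ²ρu = 0` on `Ω`. -/
def ResSystem (t : Fin 3 → Fin 3 → E3 → ℝ) (lam mu rho : E3 → ℝ) (κ : ℝ)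
    (u : E3 → Fin 3 → ℝ) (Ω : Set E3) : Prop :=
  ∀ x ∈ Ω, ∀ i : Fin 3,
    (∑ j, pd j (fun y => stress t lam mu u y i j) x) + κ ^ 2 * rho x * u x i = 0

/-- The vector `U = (u, ∇·u, ∇×u) : Ω → ℝ⁷`. -/
def Ufull (u : E3 → Fin 3 → ℝ) : E3 → Fin 7 → ℝ :=
  fun x => ![u x 0, u x 1, u x 2, divg u x, curl u x 0, curl u x 1, curl u x 2]

/-- The lower-order term `Σ_{|β|≤3} a_β ∂^β U`, component `i`. -/
def lowOrd (aβ : (Fin 3 → ℕ) → E3 → Fin 7 → Fin 7 → ℝ) (U : E3 → Fin 7 → ℝ)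
    (x : E3) (i : Fin 7) : ℝ :=
  ∑ β ∈ Finset.univ.filter (fun β : Fin 3 → Fin 4 => mdeg (fun k => (β k : ℕ)) ≤ 3),
    ∑ j, aβ (fun k => (β k : ℕ)) x i j * mpd (fun k => (β k : ℕ)) (fun y => U y j) x

/-- `f` is differentiable at `x` with partial derivatives `p i`. -/
def HasGrad (f : E3 → ℝ) (p : Fin 3 → ℝ) (x : E3) : Prop :=
  DifferentiableAt ℝ f x ∧ ∀ i, pd i f x = p i

namespace HasGrad

variable {f g : E3 → ℝ} {p q : Fin 3 → ℝ} {x : E3}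

theorem of_diff (h : DifferentiableAt ℝ f x) : HasGrad f (fun i => pd i f x) x := ⟨h, fun _ => rfl⟩

theorem congr (h : HasGrad f p x) (hpq : ∀ i, p i = q i) : HasGrad f q x :=
  ⟨h.1, fun i => (h.2 i).trans (hpq i)⟩

theorem const (c : ℝ) : HasGrad (fun _ => c) (fun _ => 0) x :=
  ⟨differentiableAt_const c, fun i => by simp [pd]⟩

theorem add (hf : HasGrad f p x) (hg : HasGrad g q x) :
    HasGrad (fun y => f y + g y) (fun i => p i + q i) x :=
  ⟨hf.1.add hg.1, fun i => by
    beta_reduce; rw [← hf.2, ← hg.2]; simp only [pd]; rw [fderiv_fun_add hf.1 hg.1]; rfl⟩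

theorem mul (hf : HasGrad f p x) (hg : HasGrad g q x) :
    HasGrad (fun y => f y * g y) (fun i => p i * g x + f x * q i) x :=
  ⟨hf.1.mul hg.1, fun i => by
    beta_reduce; rw [← hf.2, ← hg.2]; simp only [pd]; rw [fderiv_fun_mul hf.1 hg.1]
    simp; ring⟩

theorem const_mul (c : ℝ) (hg : HasGrad g q x) :
    HasGrad (fun y => c * g y) (fun i => c * q i) x :=
  ((const c).mul hg).congr fun i => by ring

theorem comp {F : ℝ → ℝ} {F' : ℝ} (hF : HasDerivAt F F' (f x)) (hf : HasGrad f p x) :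
    HasGrad (fun y => F (f y)) (fun i => F' * p i) x := by
  have h := hF.comp_hasFDerivAt x hf.1.hasFDerivAt
  refine ⟨h.differentiableAt, fun i => ?_⟩
  beta_reduce
  rw [← hf.2]
  have h2 : fderiv ℝ (fun y => F (f y)) x = F' • fderiv ℝ f x := h.fderiv
  simp [pd, h2]

theorem sum {ι : Type*} (s : Finset ι) {f : ι → E3 → ℝ} {p : ι → Fin 3 → ℝ}
    (h : ∀ k ∈ s, HasGrad (f k) (p k) x) :
    HasGrad (fun y => ∑ k ∈ s, f k y) (fun i => ∑ k ∈ s, p k i) x := by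
  classical
  induction s using Finset.induction_on with
  | empty => simpa using const 0
  | insert a s ha ih =>
    simp only [Finset.sum_insert ha]
    exact (h a (by simp)).add (ih fun k hk => h k (by simp [hk]))

theorem coord (k : Fin 3) : HasGrad (fun y => y k) (fun i => if i = k then 1 else 0) x := by
  have h : HasFDerivAt (fun y : E3 => y k) (EuclideanSpace.proj k : E3 →L[ℝ] ℝ) x :=
    (EuclideanSpace.proj k : E3 →L[ℝ] ℝ).hasFDerivAt
  refine ⟨h.differentiableAt, fun i => ?_⟩
  simp only [pd, h.fderiv]
  simp [eq_comm]

theorem norm_sq : HasGrad (fun y => ‖y‖ ^ 2) (fun i => 2 * x i) x := by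
  have : (fun y : E3 => ‖y‖ ^ 2) = fun y => ∑ k, y k * y k := by
    funext y; rw [EuclideanSpace.norm_sq_eq]; simp [sq]
  rw [this]
  refine (sum _ fun k _ => (coord k).mul (coord k)).congr fun i => ?_
  fin_cases i <;> simp [Fin.sum_univ_three] <;> ring

theorem norm_rpow (hx : x ≠ 0) (γ : ℝ) :
    HasGrad (fun y => ‖y‖ ^ γ) (fun i => γ * (‖x‖ ^ γ / ‖x‖ ^ 2) * x i) x := by
  have hn : 0 < ‖x‖ := norm_pos_iff.2 hx
  have h1 : (fun y : E3 => ‖y‖ ^ γ) = fun y => (‖y‖ ^ 2) ^ (γ / 2) := by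
    funext y
    rw [← Real.rpow_natCast, ← Real.rpow_mul (norm_nonneg _)]; congr 1; push_cast; ring
  rw [h1]
  refine (comp (Real.hasDerivAt_rpow_const (Or.inl (by positivity))) norm_sq).congr fun i => ?_
  have h2 : (‖x‖ ^ 2) ^ (γ / 2 - 1) = ‖x‖ ^ γ / ‖x‖ ^ 2 := by
    rw [Real.rpow_sub_one (by positivity), ← Real.rpow_natCast, ← Real.rpow_mul (norm_nonneg _)]
    congr 2; push_cast; ring
  rw [h2]; ring

theorem congr_of_eventuallyEq (hf : HasGrad f p x) (h : g =ᶠ[nhds x] f) : HasGrad g p x :=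
  ⟨hf.1.congr_of_eventuallyEq h, fun i => by rw [← hf.2]; simp [pd, h.fderiv_eq]⟩

end HasGrad

theorem two_le_infty : (2 : WithTop ℕ∞) ≤ ((⊤ : ℕ∞) : WithTop ℕ∞) :=
  WithTop.coe_le_coe.2 (le_top : (2 : ℕ∞) ≤ ⊤)

theorem pd_comm {f : E3 → ℝ} (hf : ContDiff ℝ (⊤ : ℕ∞) f) (j k : Fin 3) (x : E3) :
    pd j (pd k f) x = pd k (pd j f) x := by
  have hd : DifferentiableAt ℝ (fderiv ℝ f) x :=
    ((hf.fderiv_right (m := 1) two_le_infty).differentiable (by simp)) x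
  have h (v w : E3) : fderiv ℝ (fun y => fderiv ℝ f y v) x w = fderiv ℝ (fderiv ℝ f) x w v := by
    rw [fderiv_clm_apply hd (by fun_prop)]; simp
  have hs : IsSymmSndFDerivAt ℝ f x :=
    (hf.contDiffAt).isSymmSndFDerivAt (by simpa using two_le_infty)
  change fderiv ℝ (fun y => fderiv ℝ f y _) x _ = fderiv ℝ (fun y => fderiv ℝ f y _) x _
  rw [h, h]
  exact hs.eq _ _

theorem ContDiff.pd {f : E3 → ℝ} (hf : ContDiff ℝ (⊤ : ℕ∞) f) (j : Fin 3) :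
    ContDiff ℝ (⊤ : ℕ∞) (pd j f) :=
  (hf.fderiv_right (m := (⊤ : ℕ∞)) (by exact_mod_cast le_top)).clm_apply contDiff_const

theorem tsupport_pd_subset (f : E3 → ℝ) (j : Fin 3) : tsupport (pd j f) ⊆ tsupport f := by
  refine closure_minimal (fun x hx => ?_) (isClosed_tsupport f)
  by_contra h
  exact hx (by simp [pd, fderiv_of_notMem_tsupport ℝ h])

theorem continuous_mul_of_tsupport {U : Set E3} (hU : IsOpen U) {g w : E3 → ℝ}
    (hg : ContinuousOn g U) (hw : Continuous w) (hs : tsupport w ⊆ U) :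
    Continuous fun x => g x * w x := by
  refine continuous_of_tsupport fun x hx => ?_
  have hxU : x ∈ U := hs (tsupport_mul_subset_right hx)
  exact (hg.continuousAt (hU.mem_nhds hxU)).mul hw.continuousAt

theorem integrable_mul_of_tsupport {U : Set E3} (hU : IsOpen U) {g w : E3 → ℝ}
    (hg : ContinuousOn g U) (hw : Continuous w) (hc : HasCompactSupport w) (hs : tsupport w ⊆ U) :
    Integrable fun x => g x * w x :=
  (continuous_mul_of_tsupport hU hg hw hs).integrable_of_hasCompactSupport hc.mul_left

theorem continuousOn_pd {U : Set E3} (hU : IsOpen U) {g : E3 → ℝ}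
    (hg : ContDiffOn ℝ (⊤ : ℕ∞) g U) (i : Fin 3) : ContinuousOn (pd i g) U :=
  (hg.continuousOn_fderiv_of_isOpen hU (by simp)).clm_apply continuousOn_const

theorem integral_mul_pd {U : Set E3} (hU : IsOpen U) {g w : E3 → ℝ}
    (hg : ContDiffOn ℝ (⊤ : ℕ∞) g U) (hw : ContDiff ℝ (⊤ : ℕ∞) w) (hc : HasCompactSupport w)
    (hs : tsupport w ⊆ U) (i : Fin 3) :
    ∫ x, g x * pd i w x = - ∫ x, pd i g x * w x := by
  refine integral_mul_fderiv_eq_neg_fderiv_mul_of_integrable ?_ ?_ ?_ ?_ ?_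
  · exact integrable_mul_of_tsupport hU (continuousOn_pd hU hg i) hw.continuous hc hs
  · exact integrable_mul_of_tsupport hU hg.continuousOn (hw.pd i).continuous
      (hc.mono' (subset_tsupport _ |>.trans (tsupport_pd_subset w i)))
      ((tsupport_pd_subset w i).trans hs)
  · exact integrable_mul_of_tsupport hU hg.continuousOn hw.continuous hc hs
  · intro x hx
    exact (hg.contDiffAt (hU.mem_nhds (hs hx))).differentiableAt (by simp)
  · intro x _
    exact hw.differentiable (by simp) x

theorem integrable_of_continuousOn {U K : Set E3} (hU : IsOpen U) (hK : IsCompact K) (hKU : K ⊆ U)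
    {F : E3 → ℝ} (hF : ContinuousOn F U) (h0 : ∀ x ∉ K, F x = 0) : Integrable F := by
  have hs : tsupport F ⊆ K := closure_minimal (fun x hx => by
    by_contra h; exact hx (h0 x h)) hK.isClosed
  refine Continuous.integrable_of_hasCompactSupport ?_ (hK.of_isClosed_subset isClosed_closure hs)
  exact continuous_of_tsupport fun x hx => hF.continuousAt (hU.mem_nhds (hKU (hs hx)))

/-- Both functions are integrable, with the same integral. -/
structure IntEq (f g : E3 → ℝ) : Prop where
  left : Integrable f
  right : Integrable g
  eq : ∫ x, f x = ∫ x, g x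

namespace IntEq

variable {f g f₁ f₂ g₁ g₂ : E3 → ℝ}

theorem rfl' (h : Integrable f) : IntEq f f := ⟨h, h, rfl⟩

theorem add (h₁ : IntEq f₁ g₁) (h₂ : IntEq f₂ g₂) :
    IntEq (fun x => f₁ x + f₂ x) (fun x => g₁ x + g₂ x) :=
  ⟨h₁.1.add h₂.1, h₁.2.add h₂.2, by
    rw [integral_add h₁.1 h₂.1, integral_add h₁.2 h₂.2, h₁.3, h₂.3]⟩

theorem const_mul (c : ℝ) (h : IntEq f g) : IntEq (fun x => c * f x) (fun x => c * g x) :=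
  ⟨h.1.const_mul c, h.2.const_mul c, by rw [integral_const_mul, integral_const_mul, h.3]⟩

theorem sum {ι : Type*} (s : Finset ι) {f g : ι → E3 → ℝ} (h : ∀ i ∈ s, IntEq (f i) (g i)) :
    IntEq (fun x => ∑ i ∈ s, f i x) (fun x => ∑ i ∈ s, g i x) :=
  ⟨integrable_finsetSum _ fun i hi => (h i hi).1, integrable_finsetSum _ fun i hi => (h i hi).2, by
    rw [integral_finsetSum _ fun i hi => (h i hi).1, integral_finsetSum _ fun i hi => (h i hi).2]
    exact Finset.sum_congr rfl fun i hi => (h i hi).3⟩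

theorem congr (h : IntEq f g) (hf : ∀ x, f x = f₁ x) (hg : ∀ x, g x = g₁ x) : IntEq f₁ g₁ := by
  rwa [← funext hf, ← funext hg]

end IntEq

theorem pd_mul {f g : E3 → ℝ} (hf : ContDiff ℝ (⊤ : ℕ∞) f) (hg : ContDiff ℝ (⊤ : ℕ∞) g) (i : Fin 3)
    (x : E3) : pd i (fun y => f y * g y) x = pd i f x * g x + f x * pd i g x :=
  ((HasGrad.of_diff (hf.differentiable (by simp) x)).mul
    (HasGrad.of_diff (hg.differentiable (by simp) x))).2 i

section IntegrationByParts

variable {U : Set E3} {v : E3 → ℝ}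

theorem intEq_mul_pd (hU : IsOpen U) {g w : E3 → ℝ}
    (hg : ContDiffOn ℝ (⊤ : ℕ∞) g U) (hw : ContDiff ℝ (⊤ : ℕ∞) w) (hc : HasCompactSupport w)
    (hs : tsupport w ⊆ U) (i : Fin 3) :
    IntEq (fun x => g x * pd i w x) (fun x => - (pd i g x * w x)) := by
  refine ⟨?_, (integrable_mul_of_tsupport hU (continuousOn_pd hU hg i) hw.continuous hc hs).neg, ?_⟩
  · exact integrable_mul_of_tsupport hU hg.continuousOn (hw.pd i).continuous
      (hc.mono' (subset_tsupport _ |>.trans (tsupport_pd_subset w i)))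
      ((tsupport_pd_subset w i).trans hs)
  · rw [integral_mul_pd hU hg hw hc hs i, integral_neg]

theorem intEq_mul_pd_mul (hU : IsOpen U) (hc : HasCompactSupport v)
    (hs : tsupport v ⊆ U) {g f : E3 → ℝ} (hg : ContDiffOn ℝ (⊤ : ℕ∞) g U)
    (hf : ContDiff ℝ (⊤ : ℕ∞) f) (hfv : tsupport f ⊆ tsupport v) {w : E3 → ℝ}
    (hw : ContDiff ℝ (⊤ : ℕ∞) w) (i : Fin 3) :
    IntEq (fun x => g x * (pd i f x * w x + f x * pd i w x)) (fun x => - (pd i g x * (f x * w x))) := by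
  have hsub : tsupport (fun x => f x * w x) ⊆ tsupport v := tsupport_mul_subset_left.trans hfv
  exact (intEq_mul_pd hU hg (hf.mul hw) (hc.of_isClosed_subset isClosed_closure hsub)
    (hsub.trans hs) i).congr (fun x => by rw [pd_mul hf hw]) fun x => rfl

theorem intEq_hessian_mul_pd (hU : IsOpen U) (hv : ContDiff ℝ (⊤ : ℕ∞) v)
    (hc : HasCompactSupport v) (hs : tsupport v ⊆ U) {g : E3 → ℝ} (hg : ContDiffOn ℝ (⊤ : ℕ∞) g U)
    (i j k : Fin 3) :
    IntEq (fun x => g x * pd j (pd k v) x * pd i v x)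
      (fun x => -(1 / 2) * (pd j g x * pd k v x * pd i v x + pd k g x * pd j v x * pd i v x
        - pd i g x * pd j v x * pd k v x)) := by
  have key (l m n : Fin 3) := intEq_mul_pd_mul hU hc hs hg (hv.pd m) (tsupport_pd_subset v m)
    (hv.pd n) l
  refine ((((key j k i).add (key k j i)).add ((key i j k).const_mul (-1))).const_mul (1 / 2)).congr
    (fun x => ?_) (fun x => ?_)
  · rw [pd_comm hv j i, pd_comm hv k j, pd_comm hv k i]; ring
  · ring

theorem intEq_mul_hessian (hU : IsOpen U) (hv : ContDiff ℝ (⊤ : ℕ∞) v)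
    (hc : HasCompactSupport v) (hs : tsupport v ⊆ U) {g : E3 → ℝ} (hg : ContDiffOn ℝ (⊤ : ℕ∞) g U)
    (j k : Fin 3) :
    IntEq (fun x => g x * v x * pd j (pd k v) x)
      (fun x => -(g x * pd j v x * pd k v x + pd j g x * v x * pd k v x)) := by
  have h1 := intEq_mul_pd_mul hU hc hs hg hv subset_rfl (hv.pd k) j
  have h2 : Integrable fun x => g x * (pd j v x * pd k v x) := by
    refine integrable_mul_of_tsupport hU hg.continuousOn
      ((hv.pd j).continuous.mul (hv.pd k).continuous) ?_ ?_
    · exact hc.of_isClosed_subset isClosed_closure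
        (tsupport_mul_subset_left.trans (tsupport_pd_subset v j))
    · exact (tsupport_mul_subset_left.trans (tsupport_pd_subset v j)).trans hs
  exact (h1.add (IntEq.rfl' (h2.const_mul (-1)))).congr (fun x => by ring) (fun x => by ring)

theorem intEq_mul_mul_pd (hU : IsOpen U) (hv : ContDiff ℝ (⊤ : ℕ∞) v)
    (hc : HasCompactSupport v) (hs : tsupport v ⊆ U) {g : E3 → ℝ} (hg : ContDiffOn ℝ (⊤ : ℕ∞) g U)
    (i : Fin 3) :
    IntEq (fun x => g x * v x * pd i v x) (fun x => -(1 / 2) * (pd i g x * v x ^ 2)) :=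
  ((intEq_mul_pd_mul hU hc hs hg hv subset_rfl hv i).const_mul (1 / 2)).congr
    (fun x => by ring) (fun x => by ring)

/-- Integration by parts for the product of the two parts of the conjugated operator. -/
theorem intEq_carleman (hU : IsOpen U) (hv : ContDiff ℝ (⊤ : ℕ∞) v)
    (hc : HasCompactSupport v) (hs : tsupport v ⊆ U) {a : Fin 3 → Fin 3 → E3 → ℝ}
    (ha : ∀ j k, ContDiffOn ℝ (⊤ : ℕ∞) (a j k) U) {b : Fin 3 → E3 → ℝ}
    (hb : ∀ i, ContDiffOn ℝ (⊤ : ℕ∞) (b i) U) {h Q : E3 → ℝ} (hh : ContDiffOn ℝ (⊤ : ℕ∞) h U)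
    (hQ : ContDiffOn ℝ (⊤ : ℕ∞) Q U) (τ : ℝ) :
    IntEq (fun x => ((∑ j, ∑ k, a j k x * pd j (pd k v) x) + τ ^ 2 * Q x * v x)
        * (-2 * τ * (∑ i, b i x * pd i v x) - τ * h x * v x))
      (fun x => τ * (∑ i, ∑ j, ∑ k, (pd j (fun y => a j k y * b i y) x * pd k v x * pd i v x
          + pd k (fun y => a j k y * b i y) x * pd j v x * pd i v x
          - pd i (fun y => a j k y * b i y) x * pd j v x * pd k v x))
        + τ * (∑ j, ∑ k, (h x * a j k x * pd j v x * pd k v x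
          + pd j (fun y => h y * a j k y) x * v x * pd k v x))
        + τ ^ 3 * ((∑ i, pd i (fun y => Q y * b i y) x) - h x * Q x) * v x ^ 2) := by
  have h1 := IntEq.sum univ fun i _ => IntEq.sum univ fun j _ => IntEq.sum univ fun k _ =>
    intEq_hessian_mul_pd hU hv hc hs ((ha j k).mul (hb i)) i j k
  have h2 := IntEq.sum univ fun j _ => IntEq.sum univ fun k _ =>
    intEq_mul_hessian hU hv hc hs (hh.mul (ha j k)) j k
  have h3 := IntEq.sum univ fun i _ => intEq_mul_mul_pd hU hv hc hs (hQ.mul (hb i)) i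
  have h4 : Integrable fun x => (h x * Q x) * v x ^ 2 := by
    refine integrable_mul_of_tsupport hU (hh.mul hQ).continuousOn (hv.continuous.pow 2) ?_ ?_
    · exact hc.comp_left (g := fun t : ℝ => t ^ 2) (by simp)
    · refine subset_trans ?_ hs
      exact closure_mono fun x hx => by
        intro h0; exact hx (by simp [h0])
  refine ((((h1.const_mul (-2 * τ)).add (h2.const_mul (-τ))).add (h3.const_mul (-2 * τ ^ 3))).add
    (IntEq.rfl' (h4.const_mul (-τ ^ 3)))).congr (fun x => ?_) (fun x => ?_)
  · simp only [Fin.sum_univ_three]; ring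
  · simp only [Fin.sum_univ_three]; ring

end IntegrationByParts

theorem abs_mul_le_mul {x y X Y : ℝ} (hx : |x| ≤ X) (hy : |y| ≤ Y) : |x * y| ≤ X * Y := by
  rw [abs_mul]; exact mul_le_mul hx hy (abs_nonneg _) ((abs_nonneg _).trans hx)

theorem abs_add_le_add {x y X Y : ℝ} (hx : |x| ≤ X) (hy : |y| ≤ Y) : |x + y| ≤ X + Y :=
  (abs_add_le x y).trans (add_le_add hx hy)

theorem abs_sum_fin_three_le {f : Fin 3 → ℝ} {X : ℝ} (h : ∀ i, |f i| ≤ X) : |∑ i, f i| ≤ 3 * X := by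
  refine (abs_sum_le_sum_abs _ _).trans ((Finset.sum_le_card_nsmul _ _ X fun i _ => h i).trans ?_)
  simp

theorem abs_le_of_sum_sq {x : Fin 3 → ℝ} {r : ℝ} (hr : 0 ≤ r) (h : ∑ i, x i ^ 2 = r ^ 2)
    (i : Fin 3) : |x i| ≤ r := by
  refine abs_le_of_sq_le_sq ?_ hr
  rw [← h]
  exact Finset.single_le_sum (f := fun i => x i ^ 2) (fun i _ => sq_nonneg _) (mem_univ i)

theorem abs_mul_le_sum_sq (p : Fin 3 → ℝ) (i j : Fin 3) : |p i * p j| ≤ ∑ k, p k ^ 2 := by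
  have hS : 0 ≤ ∑ k, p k ^ 2 := Finset.sum_nonneg fun _ _ => sq_nonneg _
  have h := abs_le_of_sum_sq (Real.sqrt_nonneg (∑ k, p k ^ 2)) (Real.sq_sqrt hS).symm
  calc |p i * p j| ≤ _ := abs_mul_le_mul (h i) (h j)
    _ = _ := Real.mul_self_sqrt hS

section Pointwise

variable {a : Fin 3 → Fin 3 → ℝ} {D : Fin 3 → Fin 3 → Fin 3 → ℝ} {x y p : Fin 3 → ℝ}
  {e : Fin 3 → Fin 3 → ℝ} {B r n α κ W s : ℝ}

theorem carleman_gradient_bound (hsym : ∀ j k, a j k = a k j)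
    (ha : ∀ j k, |a j k| ≤ B) (hD : ∀ l j k, |D l j k| ≤ B)
    (hy : ∀ i, |y i| ≤ 3 * B * r) (he : ∀ l i, |e l i| ≤ 3 * B * r) (hα : 0 ≤ α) (hW : 0 ≤ W)
    (hyx : ∀ i, y i = ∑ m, a i m * x m) (hs : s = ∑ i, x i * y i) {h : ℝ}
    (hh : h = α * (W * (-(∑ i, a i i) + (α + 2) * (s * n) + 2 * κ)))
    {dG : Fin 3 → Fin 3 → Fin 3 → Fin 3 → ℝ}
    (hdG : ∀ l i j k, dG l i j k = D l j k * (-α * (W * y i))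
      + a j k * (-α * (-(α + 2) * (W * n) * x l * y i + W * (a i l + e l i)))) :
    2 * α * W * (κ * (∑ j, ∑ k, a j k * p j * p k) - (∑ i, (∑ k, a i k * p k) ^ 2)
        + (α + 2) * n * (∑ i, y i * p i) ^ 2) - 486 * B ^ 2 * α * W * r * (∑ i, p i ^ 2)
      ≤ (∑ i, ∑ j, ∑ k, (dG j i j k * p k * p i + dG k i j k * p j * p i - dG i i j k * p j * p k))
        + ∑ j, ∑ k, h * a j k * p j * p k := by
  set E : Fin 3 → Fin 3 → Fin 3 → Fin 3 → ℝ := fun l i j k => D l j k * y i + a j k * e l i with hE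
  have hEb (l i j k) : |E l i j k| ≤ 6 * B ^ 2 * r :=
    (abs_add_le_add (abs_mul_le_mul (hD l j k) (hy i)) (abs_mul_le_mul (ha j k) (he l i))).trans
      (by nlinarith)
  have hb : |∑ i, ∑ j, ∑ k, (E j i j k * (p k * p i) + E k i j k * (p j * p i)
      + (-E i i j k) * (p j * p k))| ≤ 486 * B ^ 2 * r * ∑ i, p i ^ 2 := by
    refine (abs_sum_fin_three_le fun i => abs_sum_fin_three_le fun j => abs_sum_fin_three_le fun k =>
      abs_add_le_add (abs_add_le_add (abs_mul_le_mul (hEb _ _ _ _) (abs_mul_le_sum_sq p _ _))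
        (abs_mul_le_mul (hEb _ _ _ _) (abs_mul_le_sum_sq p _ _)))
        (abs_mul_le_mul ((abs_neg _).trans_le (hEb _ _ _ _)) (abs_mul_le_sum_sq p _ _))).trans ?_
    linarith
  have hy' : ∑ i, y i * p i = ∑ j, x j * ∑ k, a j k * p k := by
    simp only [hyx, Fin.sum_univ_three, hsym 1 0, hsym 2 0, hsym 2 1]; ring
  have key : (∑ i, ∑ j, ∑ k, (dG j i j k * p k * p i + dG k i j k * p j * p i
        - dG i i j k * p j * p k)) + ∑ j, ∑ k, h * a j k * p j * p k
      = 2 * α * W * (κ * (∑ j, ∑ k, a j k * p j * p k) - (∑ i, (∑ k, a i k * p k) ^ 2)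
        + (α + 2) * n * ((∑ i, y i * p i) * (∑ j, x j * ∑ k, a j k * p k)))
        - α * W * ∑ i, ∑ j, ∑ k, (E j i j k * (p k * p i) + E k i j k * (p j * p i)
      + (-E i i j k) * (p j * p k)) := by
    simp only [hdG, hh, hs, hE, Fin.sum_univ_three, hsym 1 0, hsym 2 0, hsym 2 1]; ring
  rw [key, ← hy', ← sq]
  have := mul_le_mul_of_nonneg_left (le_of_abs_le hb) (mul_nonneg hα hW)
  linarith

theorem carleman_zeroth_bound (hsym : ∀ j k, a j k = a k j) (hx : ∀ i, |x i| ≤ r)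
    (ha : ∀ j k, |a j k| ≤ B)
    (hy : ∀ i, |y i| ≤ 3 * B * r) (he : ∀ l i, |e l i| ≤ 3 * B * r) (hα : 0 ≤ α) (hW : 0 ≤ W)
    (hs : s = ∑ i, x i * y i) {h : ℝ}
    (hh : h = α * (W * (-(∑ i, a i i) + (α + 2) * (s * n) + 2 * κ)))
    {dQb : Fin 3 → ℝ}
    (hdQb : ∀ i, dQb i = -α ^ 3 * (3 * W ^ 2 * (-(α + 2) * (W * n) * x i) * s * y i
      + W ^ 3 * ((y i + ∑ m, x m * (a m i + e i m)) * y i + s * (a i i + e i i))))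
    (hyx : ∀ i, y i = ∑ m, a i m * x m) :
    2 * α ^ 3 * W ^ 3 * ((α + 2) * n * s ^ 2 - (∑ i, y i ^ 2) - κ * s)
        - 162 * B ^ 2 * α ^ 3 * W ^ 3 * r ^ 3
      ≤ (∑ i, dQb i) - h * (α ^ 2 * W ^ 2 * s) := by
  have hr : 0 ≤ r := (abs_nonneg _).trans (hx 0)
  have hB : 0 ≤ B := (abs_nonneg _).trans (ha 0 0)
  have hsb : |s| ≤ 9 * B * r ^ 2 := by
    rw [hs]
    refine (abs_sum_fin_three_le fun i => abs_mul_le_mul (hx i) (hy i)).trans (by linarith)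
  have hb : |∑ i, ((∑ m, x m * e i m) * y i + s * e i i)| ≤ 162 * B ^ 2 * r ^ 3 := by
    refine (abs_sum_fin_three_le fun i => abs_add_le_add (abs_mul_le_mul
      (abs_sum_fin_three_le fun m => abs_mul_le_mul (hx m) (he i m)) (hy i))
      (abs_mul_le_mul hsb (he i i))).trans ?_
    linarith
  have hxa (i) : ∑ m, x m * (a m i + e i m) = y i + ∑ m, x m * e i m := by
    rw [hyx i, ← Finset.sum_add_distrib]
    exact Finset.sum_congr rfl fun m _ => by rw [hsym m i]; ring
  have key : (∑ i, dQb i) - h * (α ^ 2 * W ^ 2 * s)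
      = 2 * α ^ 3 * W ^ 3 * ((α + 2) * n * (s * ∑ i, x i * y i) - (∑ i, y i ^ 2) - κ * s)
        - α ^ 3 * W ^ 3 * ∑ i, ((∑ m, x m * e i m) * y i + s * e i i) := by
    simp only [hdQb, hxa, hh]
    generalize hz : (fun i => ∑ m, x m * e i m) = z
    simp only [funext_iff] at hz
    simp only [hz, Fin.sum_univ_three]
    rw [Fin.sum_univ_three] at hs
    linear_combination (-α ^ 3 * W ^ 3 * (α + 2) * n * s) * hs
  rw [key, ← hs, ← sq]
  have := mul_le_mul_of_nonneg_left (le_of_abs_le hb) (by positivity : 0 ≤ α ^ 3 * W ^ 3)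
  linarith

theorem carleman_cross_bound (hx : ∀ i, |x i| ≤ r) (hr : 0 < r) (hr1 : r ≤ 1) (hn : n = 1 / r ^ 2)
    (ha : ∀ j k, |a j k| ≤ B) (hD : ∀ l j k, |D l j k| ≤ B)
    (hα : 0 ≤ α) (hW : 0 ≤ W) (hs : |s| ≤ 9 * B * r ^ 2)
    {h : ℝ} (hh : h = α * (W * (-(∑ i, a i i) + (α + 2) * (s * n) + 2 * κ)))
    {ds dm dh : Fin 3 → ℝ} (hds : ∀ l, |ds l| ≤ 15 * B * r)
    (hdm : ∀ l, dm l = -(∑ i, D l i i) + (α + 2) * (ds l * n + s * (-2 * n ^ 2 * x l)))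
    (hdh : ∀ l, dh l = α * (-(α + 2) * (W * n) * x l
      * (-(∑ i, a i i) + (α + 2) * (s * n) + 2 * κ) + W * dm l)) (j k : Fin 3) :
    |dh j * a j k + h * D j j k| ≤ 2 * α * B * (α + 2) *
      (3 * B + 33 * (α + 2) * B + 2 * |κ|) * (W / r) := by
  have hB : 0 ≤ B := (abs_nonneg _).trans (ha 0 0)
  have hn0 : 0 ≤ n := by rw [hn]; positivity
  have hnr : n * r ^ 2 = 1 := by rw [hn]; field_simp
  have hnx (l) : |n * x l| ≤ 1 / r := by
    refine (abs_mul_le_mul (abs_of_nonneg hn0).le (hx l)).trans ?_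
    rw [hn]; apply le_of_eq; field_simp
  have htr : |-(∑ i, a i i)| ≤ 3 * B := (abs_neg _).trans_le (abs_sum_fin_three_le fun i => ha i i)
  have hsn : |s * n| ≤ 9 * B := by
    refine (abs_mul_le_mul hs (abs_of_nonneg hn0).le).trans ?_
    nlinarith
  have h2 : |α + 2| = α + 2 := abs_of_nonneg (by linarith)
  set m := -(∑ i, a i i) + (α + 2) * (s * n) + 2 * κ with hm
  set M := 3 * B + 33 * (α + 2) * B + 2 * |κ| with hM
  have hM0 : 0 ≤ M := by positivity
  have hmb : |m| ≤ 3 * B + (α + 2) * (9 * B) + 2 * |κ| :=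
    abs_add_le_add (abs_add_le_add htr (abs_mul_le_mul h2.le hsn))
      (by rw [abs_mul]; simp)
  have hmM : |m| ≤ M := hmb.trans (by rw [hM]; nlinarith)
  have hr1' : 1 ≤ 1 / r := by rw [le_div_iff₀ hr]; linarith
  have hdmb (l) : |dm l| ≤ (3 * B + 33 * (α + 2) * B) * (1 / r) := by
    have e1 : |ds l * n| ≤ 15 * B * (1 / r) := by
      refine (abs_mul_le_mul (hds l) (abs_of_nonneg hn0).le).trans (le_of_eq ?_)
      rw [hn]; field_simp
    have e2 : |s * (-2 * n ^ 2 * x l)| ≤ 18 * B * (1 / r) := by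
      have : s * (-2 * n ^ 2 * x l) = -2 * ((s * n) * (n * x l)) := by ring
      rw [this, abs_mul]
      have := abs_mul_le_mul hsn (hnx l)
      norm_num; norm_num at this; linarith
    have e3 : |-(∑ i, D l i i)| ≤ 3 * B :=
      (abs_neg _).trans_le (abs_sum_fin_three_le fun i => hD l i i)
    rw [hdm]
    refine (abs_add_le_add e3 (abs_mul_le_mul h2.le (abs_add_le_add e1 e2))).trans ?_
    nlinarith
  have hdhb : |dh j| ≤ α * ((α + 2) * W * (1 / r) * M + W * (M * (1 / r))) := by
    rw [hdh]
    refine abs_mul_le_mul (abs_of_nonneg hα).le (abs_add_le_add (abs_mul_le_mul ?_ hmM)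
      (abs_mul_le_mul (abs_of_nonneg hW).le ((hdmb j).trans ?_)))
    · have : -(α + 2) * (W * n) * x j = -((α + 2) * W * (n * x j)) := by ring
      rw [this, abs_neg]
      exact abs_mul_le_mul (abs_of_nonneg (by positivity)).le (hnx j)
    · gcongr
      rw [hM]; linarith [abs_nonneg κ]
  have hhb : |h| ≤ α * (W * M) := by
    rw [hh]; exact abs_mul_le_mul (abs_of_nonneg hα).le (abs_mul_le_mul (abs_of_nonneg hW).le hmM)
  refine (abs_add_le_add (abs_mul_le_mul hdhb (ha j k)) (abs_mul_le_mul hhb (hD j j k))).trans ?_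
  have h3 : α * (W * M) * B ≤ α * (W * M) * B * (1 / r) := le_mul_of_one_le_right (by positivity) hr1'
  have h4 : 0 ≤ α * (W * M) * B * (1 / r) := by positivity
  have h5 : 0 ≤ α * (α * (W * M) * B * (1 / r)) := by positivity
  rw [div_eq_mul_one_div W r]
  nlinarith

end Pointwise

/-- Uniform bounds and positivity on `B(0, r₀)` for the coefficients of a second-order operator. -/
structure CoefBounds (a : Fin 3 → Fin 3 → E3 → ℝ) (α κ B c r₀ : ℝ) : Prop where
  alpha_pos : 0 < α
  c_pos : 0 < c
  r_pos : 0 < r₀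
  r_le : r₀ ≤ 1
  symm : ∀ j k x, a j k x = a k j x
  smooth : ∀ j k, ContDiffOn ℝ (⊤ : ℕ∞) (a j k) (ball 0 r₀)
  bound : ∀ j k, ∀ x ∈ ball (0 : E3) r₀, |a j k x| ≤ B
  bound_pd : ∀ l j k, ∀ x ∈ ball (0 : E3) r₀, |pd l (a j k) x| ≤ B
  gradient_pos : ∀ x ∈ ball (0 : E3) r₀, ∀ p : Fin 3 → ℝ, c * ∑ i, p i ^ 2
    ≤ κ * (∑ j, ∑ k, a j k x * p j * p k) - ∑ i, (∑ k, a i k x * p k) ^ 2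
  radial_pos : ∀ x ∈ ball (0 : E3) r₀, ∀ p : Fin 3 → ℝ, c * (∑ i, p i ^ 2) ^ 2
    ≤ (α + 2) * (∑ j, ∑ k, a j k x * p j * p k) ^ 2
      - (∑ i, (∑ k, a i k x * p k) ^ 2) * (∑ i, p i ^ 2)
      - κ * (∑ j, ∑ k, a j k x * p j * p k) * (∑ i, p i ^ 2)
  small : 486 * B ^ 2 * r₀ ≤ c / 2

section Weights

variable (a : Fin 3 → Fin 3 → E3 → ℝ) (α κ : ℝ)

/-- `|x|^{-α-2}`. -/
def wt (x : E3) : ℝ := ‖x‖ ^ (-α - 2)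

/-- `a(x) x`. -/
def coefMulVec (i : Fin 3) (x : E3) : ℝ := ∑ m, a i m x * x m

/-- `x · a(x) x`. -/
def coefQuad (x : E3) : ℝ := ∑ i, x i * coefMulVec a i x

/-- `a ∇φ` for `φ = |x|^{-α}`. -/
def coefGrad (i : Fin 3) (x : E3) : ℝ := -α * (wt α x * coefMulVec a i x)

/-- `a ∇φ · ∇φ` for `φ = |x|^{-α}`. -/
def coefGradSq (x : E3) : ℝ := α ^ 2 * (wt α x ^ 2 * coefQuad a x)

/-- The zeroth-order coefficient of the first-order multiplier. -/
def multCoef (x : E3) : ℝ :=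
  α * (wt α x * (-(∑ i, a i i x) + (α + 2) * (coefQuad a x * ‖x‖ ^ (-2 : ℝ)) + 2 * κ))

/-- The second-order part of the conjugated operator. -/
def symPart (τ : ℝ) (v : E3 → ℝ) (x : E3) : ℝ :=
  (∑ j, ∑ k, a j k x * pd j (pd k v) x) + τ ^ 2 * coefGradSq a α x * v x

/-- The first-order part of the conjugated operator, up to a zeroth-order term. -/
def skewPart (τ : ℝ) (v : E3 → ℝ) (x : E3) : ℝ :=
  -2 * τ * (∑ i, coefGrad a α i x * pd i v x) - τ * multCoef a α κ x * v x

/-- The integrand produced by integrating `symPart * skewPart` by parts. -/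
def carlemanDensity (τ : ℝ) (v : E3 → ℝ) (x : E3) : ℝ :=
  τ * (∑ i, ∑ j, ∑ k, (pd j (fun y => a j k y * coefGrad a α i y) x * pd k v x * pd i v x
      + pd k (fun y => a j k y * coefGrad a α i y) x * pd j v x * pd i v x
      - pd i (fun y => a j k y * coefGrad a α i y) x * pd j v x * pd k v x))
    + τ * (∑ j, ∑ k, (multCoef a α κ x * a j k x * pd j v x * pd k v x
      + pd j (fun y => multCoef a α κ y * a j k y) x * v x * pd k v x))
    + τ ^ 3 * ((∑ i, pd i (fun y => coefGradSq a α y * coefGrad a α i y) x)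
      - multCoef a α κ x * coefGradSq a α x) * v x ^ 2

end Weights

theorem contDiffOn_norm_rpow (γ : ℝ) {U : Set E3} (hU : ∀ x ∈ U, x ≠ 0) :
    ContDiffOn ℝ (⊤ : ℕ∞) (fun x : E3 => ‖x‖ ^ γ) U := fun x hx =>
  ((contDiffAt_norm ℝ (hU x hx)).rpow_const_of_ne (norm_ne_zero_iff.2 (hU x hx))).contDiffWithinAt

theorem contDiff_coord (k : Fin 3) : ContDiff ℝ (⊤ : ℕ∞) (fun x : E3 => x k) :=
  (EuclideanSpace.proj k : E3 →L[ℝ] ℝ).contDiff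

section Smooth

variable {a : Fin 3 → Fin 3 → E3 → ℝ} {α κ : ℝ} {U : Set E3}

theorem contDiffOn_coefMulVec (ha : ∀ j k, ContDiffOn ℝ (⊤ : ℕ∞) (a j k) U) (i : Fin 3) :
    ContDiffOn ℝ (⊤ : ℕ∞) (coefMulVec a i) U :=
  ContDiffOn.sum fun m _ => (ha i m).mul (contDiff_coord m).contDiffOn

theorem contDiffOn_coefQuad (ha : ∀ j k, ContDiffOn ℝ (⊤ : ℕ∞) (a j k) U) :
    ContDiffOn ℝ (⊤ : ℕ∞) (coefQuad a) U :=
  ContDiffOn.sum fun i _ => (contDiff_coord i).contDiffOn.mul (contDiffOn_coefMulVec ha i)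

theorem contDiffOn_wt (hU : ∀ x ∈ U, x ≠ 0) : ContDiffOn ℝ (⊤ : ℕ∞) (wt α) U :=
  contDiffOn_norm_rpow _ hU

theorem contDiffOn_coefGrad (ha : ∀ j k, ContDiffOn ℝ (⊤ : ℕ∞) (a j k) U) (hU : ∀ x ∈ U, x ≠ 0)
    (i : Fin 3) : ContDiffOn ℝ (⊤ : ℕ∞) (coefGrad a α i) U :=
  contDiffOn_const.mul ((contDiffOn_wt hU).mul (contDiffOn_coefMulVec ha i))

theorem contDiffOn_coefGradSq (ha : ∀ j k, ContDiffOn ℝ (⊤ : ℕ∞) (a j k) U)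
    (hU : ∀ x ∈ U, x ≠ 0) : ContDiffOn ℝ (⊤ : ℕ∞) (coefGradSq a α) U :=
  contDiffOn_const.mul (((contDiffOn_wt hU).pow 2).mul (contDiffOn_coefQuad ha))

theorem contDiffOn_multCoef (ha : ∀ j k, ContDiffOn ℝ (⊤ : ℕ∞) (a j k) U) (hU : ∀ x ∈ U, x ≠ 0) :
    ContDiffOn ℝ (⊤ : ℕ∞) (multCoef a α κ) U :=
  contDiffOn_const.mul ((contDiffOn_wt hU).mul
    (((ContDiffOn.sum fun i _ => ha i i).neg.add
      (contDiffOn_const.mul ((contDiffOn_coefQuad ha).mul (contDiffOn_norm_rpow _ hU)))).add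
      contDiffOn_const))

end Smooth

theorem sum_sq_coord (x : E3) : ∑ i, x i ^ 2 = ‖x‖ ^ 2 := by
  rw [EuclideanSpace.norm_sq_eq]; simp

theorem norm_rpow_neg_two (x : E3) : ‖x‖ ^ (-2 : ℝ) = 1 / ‖x‖ ^ 2 := by
  rw [Real.rpow_neg (norm_nonneg _), one_div]; norm_cast

theorem one_le_wt_mul_sq {α : ℝ} (hα : 0 < α) {x : E3} (hx : x ≠ 0) (h1 : ‖x‖ ≤ 1) :
    1 ≤ wt α x * ‖x‖ ^ 2 := by
  have hn : 0 < ‖x‖ := norm_pos_iff.2 hx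
  rw [wt, ← Real.rpow_natCast, ← Real.rpow_add hn]
  exact Real.one_le_rpow_of_pos_of_le_one_of_nonpos hn h1 (by push_cast; linarith)

section Gradients

variable {a : Fin 3 → Fin 3 → E3 → ℝ} {α κ : ℝ} {x : E3}

theorem hasGrad_wt (hx : x ≠ 0) :
    HasGrad (wt α) (fun l => -(α + 2) * (wt α x * ‖x‖ ^ (-2 : ℝ)) * x l) x :=
  (HasGrad.norm_rpow hx _).congr fun l => by rw [norm_rpow_neg_two, wt]; ring

theorem hasGrad_coefMulVec (ha : ∀ j k, DifferentiableAt ℝ (a j k) x) (i : Fin 3) :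
    HasGrad (coefMulVec a i) (fun l => a i l x + ∑ m, pd l (a i m) x * x m) x :=
  (HasGrad.sum _ fun m _ => (HasGrad.of_diff (ha i m)).mul (HasGrad.coord m)).congr fun l => by
    simp only [Finset.sum_add_distrib]; simp [add_comm]

theorem hasGrad_coefQuad (ha : ∀ j k, DifferentiableAt ℝ (a j k) x) :
    HasGrad (coefQuad a) (fun l => coefMulVec a l x
      + ∑ i, x i * (a i l x + ∑ m, pd l (a i m) x * x m)) x :=
  (HasGrad.sum _ fun i _ => (HasGrad.coord i).mul (hasGrad_coefMulVec ha i)).congr fun l => by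
    simp only [Finset.sum_add_distrib]; simp

theorem hasGrad_coefGrad (ha : ∀ j k, DifferentiableAt ℝ (a j k) x) (hx : x ≠ 0) (i : Fin 3) :
    HasGrad (coefGrad a α i) (fun l => -α * (-(α + 2) * (wt α x * ‖x‖ ^ (-2 : ℝ)) * x l
      * coefMulVec a i x + wt α x * (a i l x + ∑ m, pd l (a i m) x * x m))) x :=
  ((hasGrad_wt hx).mul (hasGrad_coefMulVec ha i)).const_mul (-α)

theorem hasGrad_multCoef (ha : ∀ j k, DifferentiableAt ℝ (a j k) x) (hx : x ≠ 0) :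
    HasGrad (multCoef a α κ) (fun l => α * (-(α + 2) * (wt α x * ‖x‖ ^ (-2 : ℝ)) * x l
      * (-(∑ i, a i i x) + (α + 2) * (coefQuad a x * ‖x‖ ^ (-2 : ℝ)) + 2 * κ)
      + wt α x * (-(∑ i, pd l (a i i) x) + (α + 2) * ((coefMulVec a l x
      + ∑ i, x i * (a i l x + ∑ m, pd l (a i m) x * x m)) * ‖x‖ ^ (-2 : ℝ)
      + coefQuad a x * (-2 * (‖x‖ ^ (-2 : ℝ)) ^ 2 * x l))))) x := by
  have h1 : HasGrad (fun y : E3 => ‖y‖ ^ (-2 : ℝ)) (fun l => -2 * (‖x‖ ^ (-2 : ℝ)) ^ 2 * x l) x :=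
    (HasGrad.norm_rpow hx _).congr fun l => by rw [norm_rpow_neg_two]; ring
  have h2 := (((HasGrad.sum univ fun i _ => HasGrad.of_diff (ha i i)).const_mul (-1)).add
    (((hasGrad_coefQuad ha).mul h1).const_mul (α + 2))).add (HasGrad.const (x := x) (2 * κ))
  refine ((((hasGrad_wt (α := α) hx).mul h2).const_mul α).congr_of_eventuallyEq
    (Filter.Eventually.of_forall fun y => ?_)).congr fun l => ?_
  · simp [multCoef]
  · simp

theorem hasGrad_coefGradSq_mul_coefGrad (ha : ∀ j k, DifferentiableAt ℝ (a j k) x) (hx : x ≠ 0)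
    (i : Fin 3) :
    HasGrad (fun y => coefGradSq a α y * coefGrad a α i y) (fun l => -α ^ 3 * (3 * wt α x ^ 2
      * (-(α + 2) * (wt α x * ‖x‖ ^ (-2 : ℝ)) * x l) * coefQuad a x * coefMulVec a i x
      + wt α x ^ 3 * ((coefMulVec a l x + ∑ i, x i * (a i l x + ∑ m, pd l (a i m) x * x m))
      * coefMulVec a i x + coefQuad a x * (a i l x + ∑ m, pd l (a i m) x * x m)))) x := by
  have hw := hasGrad_wt (α := α) hx
  refine (((hw.mul (hw.mul hw)).mul ((hasGrad_coefQuad ha).mul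
    (hasGrad_coefMulVec ha i))).const_mul (-α ^ 3)).congr_of_eventuallyEq
    (Filter.Eventually.of_forall fun y => ?_) |>.congr fun l => ?_
  · simp only [coefGradSq, coefGrad]; ring
  · ring

end Gradients

theorem neg_le_mul_mul_of_abs_le {X M W r z q η : ℝ} (hX : |X| ≤ M * (W / r)) (hr : 0 < r)
    (hW : 0 ≤ W) (hη : 0 < η) :
    -(W * (η * q ^ 2 + M ^ 2 / (4 * η) * (z ^ 2 / r ^ 2))) ≤ X * z * q := by
  have h1 : |X * z * q| ≤ M * (W / r) * |z| * |q| := by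
    rw [abs_mul, abs_mul]; gcongr
  have h2 : M * (W / r) * |z| * |q| ≤ W * (η * q ^ 2 + M ^ 2 / (4 * η) * (z ^ 2 / r ^ 2)) := by
    rw [← sq_abs q, ← sq_abs z]
    have : W * (η * |q| ^ 2 + M ^ 2 / (4 * η) * (|z| ^ 2 / r ^ 2)) - M * (W / r) * |z| * |q|
        = W * η * (|q| - M / (2 * η) * (|z| / r)) ^ 2 := by
      field_simp; ring
    have h3 : 0 ≤ W * η * (|q| - M / (2 * η) * (|z| / r)) ^ 2 := by positivity
    linarith
  linarith [neg_abs_le (X * z * q)]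

section Density

variable {a : Fin 3 → Fin 3 → E3 → ℝ} {α κ B c r₀ : ℝ}

/-- The constant bounding the derivatives of the zeroth-order multiplier coefficient. -/
def crossConst (α κ B : ℝ) : ℝ := 2 * α * B * (α + 2) * (3 * B + 33 * (α + 2) * B + 2 * |κ|)

set_option maxHeartbeats 1600000 in
theorem carlemanDensity_lower_bound (H : CoefBounds a α κ B c r₀) {τ : ℝ} (hτ : 0 < τ)
    (hτ' : 27 * crossConst α κ B ^ 2 ≤ α ^ 4 * c ^ 2 * τ ^ 2) (v : E3 → ℝ) {x : E3}
    (hx0 : x ≠ 0) (hxr : x ∈ ball (0 : E3) r₀) :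
    α * c * τ * wt α x * (∑ i, pd i v x ^ 2) + α ^ 3 * c * τ ^ 3 * wt α x ^ 3 * ‖x‖ ^ 2 * v x ^ 2
      ≤ carlemanDensity a α κ τ v x := by
  have hα := H.alpha_pos
  have hc := H.c_pos
  have hr : 0 < ‖x‖ := norm_pos_iff.2 hx0
  have hrr : ‖x‖ ≤ r₀ := by simpa using (mem_ball_zero_iff.1 hxr).le
  have hr1 : ‖x‖ ≤ 1 := hrr.trans H.r_le
  have hW : 0 < wt α x := Real.rpow_pos_of_pos hr _
  have hW1 := one_le_wt_mul_sq hα hx0 hr1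
  have hxs := sum_sq_coord x
  have hx : ∀ i, |x i| ≤ ‖x‖ := abs_le_of_sum_sq hr.le hxs
  have ha (j k) := H.bound j k x hxr
  have hD (l j k) := H.bound_pd l j k x hxr
  have hB : 0 ≤ B := (abs_nonneg _).trans (ha 0 0)
  have hsym (j k) : a j k x = a k j x := H.symm j k x
  have hdiff (j k) : DifferentiableAt ℝ (a j k) x :=
    ((H.smooth j k).contDiffAt (isOpen_ball.mem_nhds hxr)).differentiableAt (by simp)
  have hy (i) : |coefMulVec a i x| ≤ 3 * B * ‖x‖ := by
    rw [mul_assoc]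
    exact abs_sum_fin_three_le fun m => abs_mul_le_mul (ha i m) (hx m)
  have he (l i) : |∑ m, pd l (a i m) x * x m| ≤ 3 * B * ‖x‖ := by
    rw [mul_assoc]
    exact abs_sum_fin_three_le fun m => abs_mul_le_mul (hD l i m) (hx m)
  have hsb : |coefQuad a x| ≤ 9 * B * ‖x‖ ^ 2 := by
    refine (abs_sum_fin_three_le fun i => abs_mul_le_mul (hx i) (hy i)).trans (by linarith)
  have hds (l) : |coefMulVec a l x + ∑ i, x i * (a i l x + ∑ m, pd l (a i m) x * x m)|
      ≤ 15 * B * ‖x‖ := by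
    refine (abs_add_le_add (hy l) (abs_sum_fin_three_le fun i => abs_mul_le_mul (hx i)
      (abs_add_le_add (ha i l) (he l i)))).trans ?_
    nlinarith [mul_nonneg hB hr.le]
  have hn := norm_rpow_neg_two x
  have hG (i j k) := (HasGrad.of_diff (hdiff j k)).mul (hasGrad_coefGrad (α := α) hdiff hx0 i)
  have hQ (i) := hasGrad_coefGradSq_mul_coefGrad (α := α) hdiff hx0 i
  have hm := hasGrad_multCoef (α := α) (κ := κ) hdiff hx0
  have hh (j k) := hm.mul (HasGrad.of_diff (hdiff j k))
  have b1 := carleman_gradient_bound (p := fun i => pd i v x) (n := ‖x‖ ^ (-2 : ℝ)) (κ := κ)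
    hsym ha hD hy he hα.le hW.le (fun i => rfl) (s := coefQuad a x) rfl (h := multCoef a α κ x) rfl
    (dG := fun l i j k => pd l (fun y => a j k y * coefGrad a α i y) x)
    (fun l i j k => (hG i j k).2 l)
  have b2 := carleman_zeroth_bound (n := ‖x‖ ^ (-2 : ℝ)) (κ := κ)
    hsym hx ha hy he hα.le hW.le (s := coefQuad a x) rfl (h := multCoef a α κ x) rfl
    (dQb := fun i => pd i (fun y => coefGradSq a α y * coefGrad a α i y) x)
    (fun i => (hQ i).2 i) (fun i => rfl)
  have b3 (j k) := carleman_cross_bound hx hr hr1 hn ha hD hα.le hW.le hsb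
    (h := multCoef a α κ x) rfl hds (fun l => rfl) (fun l => rfl) j k
  simp only [← (hh _ _).2] at b3
  have b4 (j k) := neg_le_mul_mul_of_abs_le (z := v x) (q := pd k v x) (b3 j k) hr hW.le
    (by positivity : 0 < α * c / 6)
  have b5 : -(wt α x * (α * c / 2 * (∑ i, pd i v x ^ 2)
      + 27 / 2 * (crossConst α κ B ^ 2 / (α * c)) * (v x ^ 2 / ‖x‖ ^ 2)))
      ≤ ∑ j, ∑ k, pd j (fun y => multCoef a α κ y * a j k y) x * v x * pd k v x := by
    refine le_trans (le_of_eq ?_) (Finset.sum_le_sum fun j _ => Finset.sum_le_sum fun k _ => b4 j k)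
    rw [crossConst]
    simp only [Fin.sum_univ_three]
    field_simp
    ring
  have b6 := H.gradient_pos x hxr (fun i => pd i v x)
  have b7 := H.radial_pos x hxr x
  have hquad : ∑ j, ∑ k, a j k x * x j * x k = coefQuad a x := by
    simp only [coefQuad, coefMulVec, Fin.sum_univ_three]; ring
  rw [hxs, hquad] at b7
  have b8 : c * ‖x‖ ^ 2 ≤ (α + 2) * ‖x‖ ^ (-2 : ℝ) * coefQuad a x ^ 2
      - (∑ i, coefMulVec a i x ^ 2) - κ * coefQuad a x := by
    rw [hn]
    refine le_of_mul_le_mul_right ?_ (by positivity : 0 < ‖x‖ ^ 2)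
    have : ((α + 2) * (1 / ‖x‖ ^ 2) * coefQuad a x ^ 2
      - (∑ i, coefMulVec a i x ^ 2) - κ * coefQuad a x) * ‖x‖ ^ 2
      = (α + 2) * coefQuad a x ^ 2 - (∑ i, coefMulVec a i x ^ 2) * ‖x‖ ^ 2
        - κ * coefQuad a x * ‖x‖ ^ 2 := by
      field_simp
    rw [this]
    calc c * ‖x‖ ^ 2 * ‖x‖ ^ 2 = c * (‖x‖ ^ 2) ^ 2 := by ring
      _ ≤ _ := b7
  have hsmall : 486 * B ^ 2 * ‖x‖ ≤ c / 2 := le_trans (by gcongr) H.small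
  set P := ∑ i, pd i v x ^ 2 with hP
  have hP0 : 0 ≤ P := Finset.sum_nonneg fun _ _ => sq_nonneg _
  set W := wt α x with hWdef
  set r := ‖x‖ with hrdef
  have c1 : α * W * (2 * c * P - c / 2 * P) ≤ 2 * α * W * (κ * (∑ j, ∑ k, a j k x * pd j v x * pd k v x)
      - (∑ i, (∑ k, a i k x * pd k v x) ^ 2) + (α + 2) * r ^ (-2 : ℝ)
      * (∑ i, coefMulVec a i x * pd i v x) ^ 2) - 486 * B ^ 2 * α * W * r * P := by
    have h1 : 0 ≤ (α + 2) * r ^ (-2 : ℝ) * (∑ i, coefMulVec a i x * pd i v x) ^ 2 := by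
      rw [hn]; positivity
    have h2 : 486 * B ^ 2 * r * P ≤ c / 2 * P := by gcongr
    have h3 := mul_le_mul_of_nonneg_left (add_le_add (add_le_add b6 b6) h2) (mul_pos hα hW).le
    have h4 := mul_nonneg (mul_pos hα hW).le h1
    linarith
  have c2 : α ^ 3 * W ^ 3 * r ^ 2 * (3 / 2 * c) ≤ 2 * α ^ 3 * W ^ 3 * ((α + 2) * r ^ (-2 : ℝ)
      * coefQuad a x ^ 2 - (∑ i, coefMulVec a i x ^ 2) - κ * coefQuad a x)
        - 162 * B ^ 2 * α ^ 3 * W ^ 3 * r ^ 3 := by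
    have h1 := mul_le_mul_of_nonneg_left b8 (by positivity : 0 ≤ 2 * α ^ 3 * W ^ 3)
    have h2 : 162 * B ^ 2 * r ≤ c / 2 := by
      have : 0 ≤ B ^ 2 * r := by positivity
      linarith
    have h3 := mul_le_mul_of_nonneg_left h2 (by positivity : 0 ≤ α ^ 3 * W ^ 3 * r ^ 2)
    nlinarith
  have c3 : 27 / 2 * (crossConst α κ B ^ 2 / (α * c)) * (v x ^ 2 / r ^ 2) * W
      ≤ α ^ 3 * c / 2 * τ ^ 2 * W ^ 3 * r ^ 2 * v x ^ 2 := by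
    have h1 : 27 / 2 * (crossConst α κ B ^ 2 / (α * c)) ≤ α ^ 3 * c / 2 * τ ^ 2 := by
      rw [← mul_div_assoc, div_le_iff₀ (by positivity)]
      nlinarith
    have h2 : v x ^ 2 / r ^ 2 ≤ v x ^ 2 / r ^ 2 * (W * r ^ 2) ^ 2 :=
      le_mul_of_one_le_right (by positivity) (one_le_pow₀ hW1)
    calc _ ≤ α ^ 3 * c / 2 * τ ^ 2 * (v x ^ 2 / r ^ 2 * (W * r ^ 2) ^ 2) * W := by gcongr
      _ = _ := by field_simp
  rw [carlemanDensity]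
  simp only [Finset.sum_add_distrib (f := fun k => multCoef a α κ x * a _ k x * pd _ v x * pd k v x)]
  rw [Finset.sum_add_distrib (f := fun j => ∑ k, multCoef a α κ x * a j k x * pd j v x * pd k v x)]
  have d1 := mul_le_mul_of_nonneg_left (c1.trans b1) hτ.le
  have d2 := mul_le_mul_of_nonneg_left b5 hτ.le
  have d3 := mul_le_mul_of_nonneg_right (mul_le_mul_of_nonneg_left (c2.trans b2)
    (by positivity : 0 ≤ τ ^ 3)) (sq_nonneg (v x))
  have d4 := mul_le_mul_of_nonneg_left c3 hτ.le
  have d5 : multCoef a α κ x * coefGradSq a α x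
      = multCoef a α κ x * (α ^ 2 * W ^ 2 * coefQuad a x) := by rw [coefGradSq, ← hWdef]; ring
  rw [d5]
  linarith

end Density

theorem pd_eq_zero_of_notMem_tsupport {v : E3 → ℝ} {x : E3} (hx : x ∉ tsupport v) (i : Fin 3) :
    pd i v x = 0 :=
  image_eq_zero_of_notMem_tsupport fun h => hx (tsupport_pd_subset v i h)

theorem pd_pd_eq_zero_of_notMem_tsupport {v : E3 → ℝ} {x : E3} (hx : x ∉ tsupport v)
    (i j : Fin 3) : pd i (pd j v) x = 0 :=
  pd_eq_zero_of_notMem_tsupport (fun h => hx (tsupport_pd_subset v j h)) i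

theorem isCompact_tsupport_of_subset_ball {v : E3 → ℝ} {r₀ : ℝ}
    (hs : tsupport v ⊆ ball (0 : E3) r₀ \ {0}) : IsCompact (tsupport v) :=
  (isCompact_closedBall (0 : E3) r₀).of_isClosed_subset (isClosed_tsupport v)
    (hs.trans (Set.sdiff_subset.trans ball_subset_closedBall))

theorem isOpen_puncturedBall (r₀ : ℝ) : IsOpen (ball (0 : E3) r₀ \ {0}) :=
  isOpen_ball.sdiff isClosed_singleton

section Conjugated

variable {a : Fin 3 → Fin 3 → E3 → ℝ} {α κ B c r₀ : ℝ}

theorem integral_conjugated_le (H : CoefBounds a α κ B c r₀) {τ : ℝ} (hτ : 0 < τ)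
    (hτ' : 27 * crossConst α κ B ^ 2 ≤ α ^ 4 * c ^ 2 * τ ^ 2) (hτκ : 4 * κ ^ 2 ≤ α * c * τ)
    {v : E3 → ℝ} (hv : ContDiff ℝ (⊤ : ℕ∞) v) (hs : tsupport v ⊆ ball (0 : E3) r₀ \ {0}) :
    ∫ x, (α * c * τ * wt α x * (∑ i, pd i v x ^ 2)
        + 1 / 2 * α ^ 3 * c * τ ^ 3 * wt α x ^ 3 * ‖x‖ ^ 2 * v x ^ 2)
      ≤ ∫ x, 1 / 2 * (symPart a α τ v x + skewPart a α κ τ v x + 2 * τ * α * κ * wt α x * v x) ^ 2 := by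
  have hα := H.alpha_pos
  have hc := H.c_pos
  set U := ball (0 : E3) r₀ \ {0} with hUdef
  have hU : IsOpen U := isOpen_puncturedBall r₀
  have hK := isCompact_tsupport_of_subset_ball hs
  have hU0 : ∀ x ∈ U, x ≠ 0 := fun x hx => hx.2
  have ha (j k) : ContDiffOn ℝ (⊤ : ℕ∞) (a j k) U := (H.smooth j k).mono Set.sdiff_subset
  have hI := intEq_carleman hU hv hK hs ha (fun i => contDiffOn_coefGrad (α := α) ha hU0 i)
    (contDiffOn_multCoef (α := α) (κ := κ) ha hU0) (contDiffOn_coefGradSq (α := α) ha hU0) τ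
  change IntEq (fun x => symPart a α τ v x * skewPart a α κ τ v x)
    (fun x => carlemanDensity a α κ τ v x) at hI
  have hvc := hv.continuous.continuousOn (s := U)
  have hpc (i) := (hv.pd i).continuous.continuousOn (s := U)
  have hppc (j k) := ((hv.pd k).pd j).continuous.continuousOn (s := U)
  have hwc := (contDiffOn_wt (α := α) hU0).continuousOn
  have hv0 {x} (hx : x ∉ tsupport v) : v x = 0 := image_eq_zero_of_notMem_tsupport hx
  have hnc : ContinuousOn (fun x : E3 => ‖x‖ ^ 2) U := (continuous_norm.pow 2).continuousOn
  have iZ : Integrable fun x => 2 * (τ * α * κ * wt α x * v x) ^ 2 :=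
    integrable_of_continuousOn hU hK hs
      (continuousOn_const.mul (((continuousOn_const.mul hwc).mul hvc).pow 2))
      fun x hx => by simp [hv0 hx]
  have iL : Integrable fun x => α * c * τ * wt α x * (∑ i, pd i v x ^ 2)
        + α ^ 3 * c * τ ^ 3 * wt α x ^ 3 * ‖x‖ ^ 2 * v x ^ 2 :=
    integrable_of_continuousOn hU hK hs
      (((continuousOn_const.mul hwc).mul (continuousOn_finsetSum _ fun i _ => (hpc i).pow 2)).add
        (((continuousOn_const.mul (hwc.pow 3)).mul hnc).mul (hvc.pow 2)))
      fun x hx => by simp [hv0 hx, pd_eq_zero_of_notMem_tsupport hx]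
  have iF : Integrable fun x =>
      1 / 2 * (symPart a α τ v x + skewPart a α κ τ v x + 2 * τ * α * κ * wt α x * v x) ^ 2 := by
    refine integrable_of_continuousOn hU hK hs
      (continuousOn_const.mul (((ContinuousOn.add ?_ ?_).add
        ((continuousOn_const.mul hwc).mul hvc)).pow 2))
      fun x hx => by
        simp [symPart, skewPart, hv0 hx, pd_eq_zero_of_notMem_tsupport hx,
          pd_pd_eq_zero_of_notMem_tsupport hx]
    · exact (continuousOn_finsetSum _ fun j _ => continuousOn_finsetSum _ fun k _ =>
        (ha j k).continuousOn.mul (hppc j k)).add ((continuousOn_const.mul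
          (contDiffOn_coefGradSq ha hU0).continuousOn).mul hvc)
    · exact (continuousOn_const.mul (continuousOn_finsetSum _ fun i _ =>
        (contDiffOn_coefGrad ha hU0 i).continuousOn.mul (hpc i))).sub ((continuousOn_const.mul
          (contDiffOn_multCoef ha hU0).continuousOn).mul hvc)
  have hLE (x) : α * c * τ * wt α x * (∑ i, pd i v x ^ 2)
        + α ^ 3 * c * τ ^ 3 * wt α x ^ 3 * ‖x‖ ^ 2 * v x ^ 2 ≤ carlemanDensity a α κ τ v x := by
    by_cases hx : x ∈ tsupport v
    · exact carlemanDensity_lower_bound H hτ hτ' v (hs hx).2 (hs hx).1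
    · simp [carlemanDensity, hv0 hx, pd_eq_zero_of_notMem_tsupport hx]
  have hZ (x) : 2 * (τ * α * κ * wt α x * v x) ^ 2
      ≤ 1 / 2 * α ^ 3 * c * τ ^ 3 * wt α x ^ 3 * ‖x‖ ^ 2 * v x ^ 2 := by
    by_cases hx : x ∈ tsupport v
    · have h1 := one_le_wt_mul_sq hα (hs hx).2
        (((mem_ball_zero_iff.1 (hs hx).1).le).trans H.r_le)
      have hW : 0 < wt α x := Real.rpow_pos_of_pos (norm_pos_iff.2 (hs hx).2) _
      have h2 : 4 * κ ^ 2 ≤ α * c * τ * (wt α x * ‖x‖ ^ 2) :=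
        hτκ.trans (le_mul_of_one_le_right (by positivity) h1)
      have h3 := mul_le_mul_of_nonneg_left h2
        (by positivity : 0 ≤ 1 / 2 * τ ^ 2 * α ^ 2 * wt α x ^ 2 * v x ^ 2)
      nlinarith
    · simp [hv0 hx]
  have hSM (x) : symPart a α τ v x * skewPart a α κ τ v x ≤
      1 / 2 * (symPart a α τ v x + skewPart a α κ τ v x + 2 * τ * α * κ * wt α x * v x) ^ 2
        + 2 * (τ * α * κ * wt α x * v x) ^ 2 := by
    nlinarith [sq_nonneg (symPart a α τ v x - skewPart a α κ τ v x),
      sq_nonneg (symPart a α τ v x + skewPart a α κ τ v x + 4 * τ * α * κ * wt α x * v x)]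
  have e1 := integral_mono iL hI.right hLE
  have e2 := integral_mono hI.left (iF.add iZ) hSM
  rw [hI.eq, integral_add' iF iZ] at e2
  have e3 := integral_mono_of_nonneg (Filter.Eventually.of_forall fun x => ?_) (iL.sub iZ)
    (Filter.Eventually.of_forall fun x => ?_)
    (f := fun x => α * c * τ * wt α x * (∑ i, pd i v x ^ 2)
        + 1 / 2 * α ^ 3 * c * τ ^ 3 * wt α x ^ 3 * ‖x‖ ^ 2 * v x ^ 2)
  · rw [integral_sub' iL iZ] at e3
    linarith
  · have : 0 ≤ wt α x := Real.rpow_nonneg (norm_nonneg _) _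
    have : 0 ≤ ∑ i, pd i v x ^ 2 := Finset.sum_nonneg fun _ _ => sq_nonneg _
    simp only [Pi.zero_apply]
    positivity
  · have := hZ x
    simp only [Pi.sub_apply]
    linarith

end Conjugated

/-- The weight `exp(τ|x|^{-α}) |x|^γ`. -/
def cwt (τ α γ : ℝ) (x : E3) : ℝ := Real.exp (τ * ‖x‖ ^ (-α)) * ‖x‖ ^ γ

/-- The radial logarithmic derivative of `cwt`, divided by `|x|`. -/
def cwtLog (τ α γ : ℝ) (x : E3) : ℝ := -(τ * α * wt α x) + γ * ‖x‖ ^ (-2 : ℝ)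

/-- The radial derivative of `cwtLog`, divided by `|x|`. -/
def cwtLogD (τ α γ : ℝ) (x : E3) : ℝ :=
  τ * α * (α + 2) * wt α x * ‖x‖ ^ (-2 : ℝ) - 2 * γ * (‖x‖ ^ (-2 : ℝ)) ^ 2

section Conjugation

variable {τ α γ : ℝ} {x : E3}

theorem contDiffOn_cwt {U : Set E3} (hU : ∀ x ∈ U, x ≠ 0) :
    ContDiffOn ℝ (⊤ : ℕ∞) (cwt τ α γ) U :=
  (contDiffOn_const.mul (contDiffOn_norm_rpow _ hU)).exp.mul (contDiffOn_norm_rpow _ hU)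

theorem hasGrad_cwt (hx : x ≠ 0) :
    HasGrad (cwt τ α γ) (fun l => cwt τ α γ x * (cwtLog τ α γ x * x l)) x := by
  have hn : 0 < ‖x‖ := norm_pos_iff.2 hx
  have hw : ‖x‖ ^ (-α) / ‖x‖ ^ 2 = wt α x := by
    rw [wt, Real.rpow_sub hn]; norm_cast
  refine ((HasGrad.comp (Real.hasDerivAt_exp _)
    ((HasGrad.norm_rpow hx (-α)).const_mul τ)).mul (HasGrad.norm_rpow hx γ)).congr fun l => ?_
  rw [hw, cwtLog, norm_rpow_neg_two, cwt]
  ring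

theorem hasGrad_cwtLog (hx : x ≠ 0) :
    HasGrad (cwtLog τ α γ) (fun l => cwtLogD τ α γ x * x l) x := by
  refine (((hasGrad_wt (α := α) hx).const_mul (-(τ * α))).add
    ((HasGrad.norm_rpow hx (-2)).const_mul γ)).congr_of_eventuallyEq
    (Filter.Eventually.of_forall fun y => ?_) |>.congr fun l => ?_
  · simp [cwtLog]
  · rw [cwtLogD, norm_rpow_neg_two]; ring

variable {u : E3 → ℝ}

theorem pd_cwt_mul (hu : ContDiff ℝ (⊤ : ℕ∞) u) (hx : x ≠ 0) (l : Fin 3) :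
    pd l (fun y => cwt τ α γ y * u y) x
      = cwt τ α γ x * (pd l u x + cwtLog τ α γ x * (x l * u x)) := by
  rw [((hasGrad_cwt hx).mul (HasGrad.of_diff (hu.differentiable (by simp) x))).2 l]
  ring

theorem pd_pd_cwt_mul (hu : ContDiff ℝ (⊤ : ℕ∞) u) (hx : x ≠ 0) (j k : Fin 3) :
    pd j (pd k (fun y => cwt τ α γ y * u y)) x
      = cwt τ α γ x * (pd j (pd k u) x + cwtLog τ α γ x * (x j * pd k u x + x k * pd j u x)
        + ((cwtLog τ α γ x ^ 2 + cwtLogD τ α γ x) * (x j * x k)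
          + cwtLog τ α γ x * (if j = k then 1 else 0)) * u x) := by
  have hd (f : E3 → ℝ) (hf : ContDiff ℝ (⊤ : ℕ∞) f) := HasGrad.of_diff (hf.differentiable (by simp) x)
  have h1 := (hasGrad_cwt (τ := τ) (α := α) (γ := γ) hx).mul ((hd _ (hu.pd k)).add
    ((hasGrad_cwtLog (τ := τ) (α := α) (γ := γ) hx).mul ((HasGrad.coord k).mul (hd u hu))))
  have h2 : pd k (fun y => cwt τ α γ y * u y) =ᶠ[nhds x] fun y =>
      cwt τ α γ y * (pd k u y + cwtLog τ α γ y * (y k * u y)) := by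
    filter_upwards [isOpen_ne.mem_nhds hx] with y hy using pd_cwt_mul hu hy k
  rw [(h1.congr_of_eventuallyEq h2).2 j]
  ring

theorem contDiff_cwt_mul (hu : ContDiff ℝ (⊤ : ℕ∞) u) (h0 : (0 : E3) ∉ tsupport u) :
    ContDiff ℝ (⊤ : ℕ∞) fun y => cwt τ α γ y * u y := by
  refine contDiff_iff_contDiffAt.2 fun x => ?_
  by_cases hxu : x ∉ tsupport u
  · refine contDiffAt_const (c := (0 : ℝ)) |>.congr_of_eventuallyEq ?_
    filter_upwards [notMem_tsupport_iff_eventuallyEq.1 hxu] with y hy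
    simp [hy]
  push Not at hxu
  have hx0 : x ≠ 0 := fun h => h0 (h ▸ hxu)
  exact ((contDiffOn_cwt (U := {0}ᶜ) fun y hy => hy).contDiffAt
    (isOpen_compl_singleton.mem_nhds hx0)).mul hu.contDiffAt

theorem conjugation_identity (a : Fin 3 → Fin 3 → E3 → ℝ) (κ : ℝ)
    (hsym : ∀ j k x, a j k x = a k j x) (hu : ContDiff ℝ (⊤ : ℕ∞) u) (hx : x ≠ 0) :
    symPart a α τ (fun y => cwt τ α 0 y * u y) x + skewPart a α κ τ (fun y => cwt τ α 0 y * u y) x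
      + 2 * τ * α * κ * wt α x * (cwt τ α 0 x * u x) = cwt τ α 0 x * op2 a u x := by
  have hb : cwtLog τ α 0 x = -(τ * α * wt α x) := by simp [cwtLog]
  have hb' : cwtLogD τ α 0 x = τ * α * (α + 2) * wt α x * ‖x‖ ^ (-2 : ℝ) := by simp [cwtLogD]
  have h01 (j k) : a j k x = a k j x := hsym j k x
  simp only [symPart, skewPart, pd_pd_cwt_mul hu hx, pd_cwt_mul hu hx, hb, hb', op2, coefGradSq,
    coefGrad, multCoef, coefQuad, coefMulVec]
  simp only [Fin.sum_univ_three, h01 1 0, h01 2 0, h01 2 1]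
  simp
  ring

end Conjugation

/-- The weighted energy of `u` and its gradient at `x`. -/
def carlemanEnergy (τ α : ℝ) (u : E3 → ℝ) (x : E3) : ℝ :=
  cwt τ α 0 x ^ 2 * (τ * wt α x * (∑ i, pd i u x ^ 2)
    + τ ^ 3 * wt α x ^ 3 * ‖x‖ ^ 2 * u x ^ 2)

theorem wt_nonneg (α : ℝ) (x : E3) : 0 ≤ wt α x := Real.rpow_nonneg (norm_nonneg _) _

theorem carlemanEnergy_nonneg {τ : ℝ} (hτ : 0 ≤ τ) (α : ℝ) (u : E3 → ℝ) (x : E3) :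
    0 ≤ carlemanEnergy τ α u x := by
  have := wt_nonneg α x
  have : 0 ≤ ∑ i, pd i u x ^ 2 := Finset.sum_nonneg fun _ _ => sq_nonneg _
  rw [carlemanEnergy]; positivity

section Energy

variable {a : Fin 3 → Fin 3 → E3 → ℝ} {α κ B c r₀ : ℝ} {u : E3 → ℝ}

theorem integrable_carlemanEnergy (τ : ℝ) (hu : ContDiff ℝ (⊤ : ℕ∞) u)
    (hs : tsupport u ⊆ ball (0 : E3) r₀ \ {0}) : Integrable (carlemanEnergy τ α u) := by
  have hU0 : ∀ x ∈ ball (0 : E3) r₀ \ {0}, x ≠ 0 := fun x hx => hx.2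
  have hwc := (contDiffOn_wt (α := α) hU0).continuousOn
  refine integrable_of_continuousOn (isOpen_puncturedBall r₀) (isCompact_tsupport_of_subset_ball hs)
    hs (((contDiffOn_cwt hU0).continuousOn.pow 2).mul
      (((continuousOn_const.mul hwc).mul (continuousOn_finsetSum _ fun i _ =>
        ((hu.pd i).continuous.continuousOn).pow 2)).add
        (((continuousOn_const.mul (hwc.pow 3)).mul (continuous_norm.pow 2).continuousOn).mul
          (hu.continuous.continuousOn.pow 2)))) fun x hx => ?_
  simp [carlemanEnergy, image_eq_zero_of_notMem_tsupport hx, pd_eq_zero_of_notMem_tsupport hx]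

theorem integrable_cwt_mul_op2_sq (H : CoefBounds a α κ B c r₀) (τ γ : ℝ)
    (hu : ContDiff ℝ (⊤ : ℕ∞) u) (hs : tsupport u ⊆ ball (0 : E3) r₀ \ {0}) :
    Integrable fun x => (cwt τ α γ x * op2 a u x) ^ 2 := by
  have hU0 : ∀ x ∈ ball (0 : E3) r₀ \ {0}, x ≠ 0 := fun x hx => hx.2
  refine integrable_of_continuousOn (isOpen_puncturedBall r₀) (isCompact_tsupport_of_subset_ball hs)
    hs (((contDiffOn_cwt hU0).continuousOn.mul (continuousOn_finsetSum _ fun j _ =>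
      continuousOn_finsetSum _ fun k _ => ((H.smooth j k).continuousOn.mono Set.sdiff_subset).mul
        ((hu.pd k).pd j).continuous.continuousOn)).pow 2) fun x hx => ?_
  simp [op2, pd_pd_eq_zero_of_notMem_tsupport hx]

theorem integral_carlemanEnergy_le (H : CoefBounds a α κ B c r₀) {τ : ℝ} (hτ : 0 < τ)
    (hτ' : 27 * crossConst α κ B ^ 2 ≤ α ^ 4 * c ^ 2 * τ ^ 2) (hτκ : 4 * κ ^ 2 ≤ α * c * τ)
    (hu : ContDiff ℝ (⊤ : ℕ∞) u) (hs : tsupport u ⊆ ball (0 : E3) r₀ \ {0}) :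
    min (α * c / 8) (α ^ 3 * c / 4) * ∫ x, carlemanEnergy τ α u x
      ≤ 1 / 2 * ∫ x, (cwt τ α 0 x * op2 a u x) ^ 2 := by
  have hα := H.alpha_pos
  have hc := H.c_pos
  have h0 : (0 : E3) ∉ tsupport u := fun h => (hs h).2 rfl
  set v : E3 → ℝ := fun y => cwt τ α 0 y * u y with hv
  have hvs : ContDiff ℝ (⊤ : ℕ∞) v := contDiff_cwt_mul hu h0
  have hvt : tsupport v ⊆ tsupport u := tsupport_mul_subset_right
  have key := integral_conjugated_le H hτ hτ' hτκ hvs (hvt.trans hs)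
  have hR (x) : 1 / 2 * (symPart a α τ v x + skewPart a α κ τ v x
      + 2 * τ * α * κ * wt α x * v x) ^ 2 = 1 / 2 * (cwt τ α 0 x * op2 a u x) ^ 2 := by
    by_cases hx : x ∈ tsupport u
    · rw [← conjugation_identity a κ H.symm hu (hs hx).2]
    · have hx' : x ∉ tsupport v := fun h => hx (hvt h)
      simp [symPart, skewPart, op2, image_eq_zero_of_notMem_tsupport hx',
        pd_eq_zero_of_notMem_tsupport hx', pd_pd_eq_zero_of_notMem_tsupport hx',
        pd_pd_eq_zero_of_notMem_tsupport hx]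
  simp only [hR, integral_const_mul (1 / 2 : ℝ)] at key
  refine le_trans ?_ key
  rw [← integral_const_mul]
  have hU0 : ∀ x ∈ ball (0 : E3) r₀ \ {0}, x ≠ 0 := fun x hx => hx.2
  have hwc := (contDiffOn_wt (α := α) hU0).continuousOn
  have iL : Integrable fun x => α * c * τ * wt α x * (∑ i, pd i v x ^ 2)
        + 1 / 2 * α ^ 3 * c * τ ^ 3 * wt α x ^ 3 * ‖x‖ ^ 2 * v x ^ 2 := by
    refine integrable_of_continuousOn (isOpen_puncturedBall r₀)
      (isCompact_tsupport_of_subset_ball (hvt.trans hs)) (hvt.trans hs)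
      (((continuousOn_const.mul hwc).mul (continuousOn_finsetSum _ fun i _ =>
        ((hvs.pd i).continuous.continuousOn).pow 2)).add
        (((continuousOn_const.mul (hwc.pow 3)).mul (continuous_norm.pow 2).continuousOn).mul
          (hvs.continuous.continuousOn.pow 2))) fun x hx => ?_
    simp [image_eq_zero_of_notMem_tsupport hx, pd_eq_zero_of_notMem_tsupport hx]
  refine integral_mono ((integrable_carlemanEnergy τ hu hs).const_mul _) iL fun x => ?_
  by_cases hx : x ∈ tsupport u
  · have hx0 : x ≠ 0 := (hs hx).2
    have hgrad (i) : pd i v x = cwt τ α 0 x * (pd i u x + cwtLog τ α 0 x * (x i * u x)) :=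
      pd_cwt_mul hu hx0 i
    have hb : cwtLog τ α 0 x = -(τ * α * wt α x) := by simp [cwtLog]
    have hW := wt_nonneg α x
    have hxs := sum_sq_coord x
    have e1 : 1 / 2 * cwt τ α 0 x ^ 2 * (∑ i, pd i u x ^ 2)
        - τ ^ 2 * α ^ 2 * wt α x ^ 2 * ‖x‖ ^ 2 * (cwt τ α 0 x ^ 2 * u x ^ 2)
        ≤ ∑ i, pd i v x ^ 2 := by
      rw [← hxs, Finset.mul_sum, Finset.mul_sum, Finset.sum_mul, ← Finset.sum_sub_distrib]
      refine Finset.sum_le_sum fun i _ => ?_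
      rw [hgrad, hb]
      nlinarith [sq_nonneg (cwt τ α 0 x * (pd i u x - 2 * (τ * α * wt α x) * (x i * u x)))]
    set G := cwt τ α 0 x
    set W := wt α x
    have hP : 0 ≤ ∑ i, pd i v x ^ 2 := Finset.sum_nonneg fun _ _ => sq_nonneg _
    have hP' : 0 ≤ ∑ i, pd i u x ^ 2 := Finset.sum_nonneg fun _ _ => sq_nonneg _
    have hvx : v x = G * u x := rfl
    rw [hvx]
    have e2 := mul_le_mul_of_nonneg_left e1 (by positivity : 0 ≤ 1 / 4 * (α * c * τ * W))
    have e3 : 0 ≤ 3 / 4 * (α * c * τ * W) * ∑ i, pd i v x ^ 2 := by positivity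
    have e4 : min (α * c / 8) (α ^ 3 * c / 4) * (G ^ 2 * (τ * W * ∑ i, pd i u x ^ 2))
        ≤ α * c / 8 * (G ^ 2 * (τ * W * ∑ i, pd i u x ^ 2)) := by
      gcongr; exact min_le_left _ _
    have e5 : min (α * c / 8) (α ^ 3 * c / 4) * (G ^ 2 * (τ ^ 3 * W ^ 3 * ‖x‖ ^ 2 * u x ^ 2))
        ≤ α ^ 3 * c / 4 * (G ^ 2 * (τ ^ 3 * W ^ 3 * ‖x‖ ^ 2 * u x ^ 2)) := by
      gcongr; exact min_le_right _ _
    calc _ = min (α * c / 8) (α ^ 3 * c / 4) * (G ^ 2 * (τ * W * ∑ i, pd i u x ^ 2))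
          + min (α * c / 8) (α ^ 3 * c / 4) * (G ^ 2 * (τ ^ 3 * W ^ 3 * ‖x‖ ^ 2 * u x ^ 2)) := by
          simp only [carlemanEnergy]; ring
      _ ≤ _ := by nlinarith
  · have hx' : x ∉ tsupport v := fun h => hx (hvt h)
    simp [carlemanEnergy, image_eq_zero_of_notMem_tsupport hx, pd_eq_zero_of_notMem_tsupport hx,
      image_eq_zero_of_notMem_tsupport hx', pd_eq_zero_of_notMem_tsupport hx']

end Energy

theorem IntEq.trans_symm {f g h : E3 → ℝ} (h₁ : IntEq f h) (h₂ : IntEq g h) : IntEq f g :=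
  ⟨h₁.1, h₂.1, h₁.3.trans h₂.3.symm⟩

open scoped MatrixOrder in
theorem trace_mul_self_le {A W : Matrix (Fin 3) (Fin 3) ℝ} (hA : A.IsSymm) (hW : W.IsSymm)
    {c₀ : ℝ} (hc : 0 ≤ c₀)
    (hell : ∀ ξ : Fin 3 → ℝ, c₀ * (∑ i, ξ i ^ 2) ≤ ∑ j, ∑ k, A j k * ξ j * ξ k) :
    c₀ ^ 2 * (W * W).trace ≤ (A * W * (A * W)).trace := by
  have hR : (A - c₀ • (1 : Matrix (Fin 3) (Fin 3) ℝ)).PosSemidef := by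
    refine Matrix.PosSemidef.of_dotProduct_mulVec_nonneg ?_ fun ξ => ?_
    · change Matrix.conjTranspose _ = _
      rw [Matrix.conjTranspose_eq_transpose_of_trivial]
      simp [hA.eq]
    · have := hell ξ
      rw [Matrix.sub_mulVec, Matrix.smul_mulVec, Matrix.one_mulVec]
      simp only [star_trivial, dotProduct, Matrix.mulVec, Fin.sum_univ_three, Pi.sub_apply,
        Pi.smul_apply, smul_eq_mul] at this ⊢
      linarith
  obtain ⟨B, hB⟩ := CStarAlgebra.nonneg_iff_eq_star_mul_self.mp hR.nonneg
  rw [Matrix.star_eq_conjTranspose, Matrix.conjTranspose_eq_transpose_of_trivial] at hB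
  have hA' : A = B.transpose * B + c₀ • 1 := by rw [← hB]; abel
  have t1 : 0 ≤ (B.transpose * B * W * (B.transpose * B * W)).trace := by
    have h := (Matrix.posSemidef_conjTranspose_mul_self (B * W * B.transpose)).trace_nonneg
    rw [Matrix.conjTranspose_eq_transpose_of_trivial] at h
    simp only [Matrix.transpose_mul, Matrix.transpose_transpose, hW.eq] at h
    rw [Matrix.mul_assoc, Matrix.mul_assoc, Matrix.trace_mul_comm]
    simpa only [Matrix.mul_assoc] using h
  have t2 : 0 ≤ (B.transpose * B * W * W).trace := by
    have h := (Matrix.posSemidef_conjTranspose_mul_self (B * W)).trace_nonneg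
    rw [Matrix.conjTranspose_eq_transpose_of_trivial] at h
    simp only [Matrix.transpose_mul, hW.eq] at h
    rw [Matrix.trace_mul_comm]
    simpa only [Matrix.mul_assoc] using h
  have e : (A * W * (A * W)).trace = (B.transpose * B * W * (B.transpose * B * W)).trace
      + 2 * c₀ * (B.transpose * B * W * W).trace + c₀ ^ 2 * (W * W).trace := by
    rw [hA']
    have : (W * (B.transpose * B * W)).trace = (B.transpose * B * W * W).trace :=
      Matrix.trace_mul_comm _ _
    simp only [add_mul, mul_add, Matrix.trace_add, Matrix.smul_mul, Matrix.mul_smul,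
      Matrix.trace_smul, Matrix.one_mul, smul_eq_mul, this]
    ring
  rw [e]
  have := mul_nonneg hc t2
  linarith

theorem intEq_hessian_mul_hessian {ω : E3 → ℝ} (hω : ContDiff ℝ (⊤ : ℕ∞) ω)
    (hc : HasCompactSupport ω) (j k l m : Fin 3) :
    IntEq (fun x => pd j (pd k ω) x * pd l (pd m ω) x)
      (fun x => pd j (pd m ω) x * pd l (pd k ω) x) := by
  have hck : HasCompactSupport (pd k ω) := hc.of_isClosed_subset isClosed_closure
    (tsupport_pd_subset ω k)
  have key (p q : Fin 3) := intEq_mul_pd isOpen_univ ((hω.pd m).pd p).contDiffOn (hω.pd k) hck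
    (Set.subset_univ _) q
  refine ((key l j).trans_symm ((key j l).congr (fun _ => rfl) fun x => ?_)).congr
    (fun x => mul_comm _ _) fun x => rfl
  rw [pd_comm (hω.pd m)]

theorem integral_hessian_sq_le {A : Fin 3 → Fin 3 → ℝ} (hA : ∀ j k, A j k = A k j) {c₀ : ℝ}
    (hc₀ : 0 ≤ c₀) (hell : ∀ ξ : Fin 3 → ℝ, c₀ * (∑ i, ξ i ^ 2) ≤ ∑ j, ∑ k, A j k * ξ j * ξ k)
    {ω : E3 → ℝ} (hω : ContDiff ℝ (⊤ : ℕ∞) ω) (hc : HasCompactSupport ω) :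
    c₀ ^ 2 * ∫ x, ∑ j, ∑ k, pd j (pd k ω) x ^ 2
      ≤ ∫ x, (∑ j, ∑ k, A j k * pd j (pd k ω) x) ^ 2 := by
  have h1 := IntEq.sum univ fun j _ => IntEq.sum univ fun k _ => IntEq.sum univ fun l _ =>
    IntEq.sum univ fun m _ => (intEq_hessian_mul_hessian hω hc j k l m).const_mul (A j k * A l m)
  have h2 := IntEq.sum univ fun j _ => IntEq.sum univ fun k _ =>
    intEq_hessian_mul_hessian hω hc j k j k
  have h3 := h1.congr (f₁ := fun x => (∑ j, ∑ k, A j k * pd j (pd k ω) x) ^ 2)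
    (fun x => by simp only [Fin.sum_univ_three]; ring) fun _ => rfl
  rw [h3.eq, ← integral_const_mul]
  refine integral_mono ((h2.left.const_mul (c₀ ^ 2)).congr (ae_of_all _ fun x => by simp only [sq]))
    h1.right fun x => ?_
  have hW : (Matrix.of fun j k => pd j (pd k ω) x).IsSymm := by
    ext j k; exact pd_comm hω _ _ _
  have hA' : (Matrix.of A).IsSymm := by ext j k; exact hA _ _
  have key := trace_mul_self_le hA' hW hc₀ hell
  simp only [Matrix.trace, Matrix.diag, Matrix.mul_apply, Matrix.of_apply, Fin.sum_univ_three,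
    pd_comm hω 1 0, pd_comm hω 2 0, pd_comm hω 2 1, hA 1 0, hA 2 0, hA 2 1] at key ⊢
  linarith

/-- The sum of the squares of the second partial derivatives. -/
def hessSq (u : E3 → ℝ) (x : E3) : ℝ := ∑ j, ∑ k, pd j (pd k u) x ^ 2

theorem hessSq_nonneg (u : E3 → ℝ) (x : E3) : 0 ≤ hessSq u x :=
  Finset.sum_nonneg fun _ _ => Finset.sum_nonneg fun _ _ => sq_nonneg _

/-- The constant in `sum_commutator_sq_le`. -/
def commConst (α : ℝ) : ℝ := 72 * α ^ 2 + 27 * (4 * α ^ 2 + α * (α + 3) + 2 * α) ^ 2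

theorem cwt_sq_eq {x : E3} (hx : x ≠ 0) (τ α : ℝ) :
    cwt τ α (α / 2) x ^ 2 = cwt τ α 0 x ^ 2 * ‖x‖ ^ α := by
  have hr : 0 < ‖x‖ := norm_pos_iff.2 hx
  simp only [cwt, mul_pow, Real.rpow_zero, ← Real.rpow_natCast (‖x‖ ^ (α / 2)) 2,
    ← Real.rpow_mul hr.le]
  norm_num

theorem rpow_mul_wt_mul_sq {x : E3} (hx : x ≠ 0) (α : ℝ) : ‖x‖ ^ α * wt α x * ‖x‖ ^ 2 = 1 := by
  have hr : 0 < ‖x‖ := norm_pos_iff.2 hx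
  rw [wt, ← Real.rpow_natCast ‖x‖ 2, ← Real.rpow_add hr, ← Real.rpow_add hr,
    show α + (-α - 2) + ((2 : ℕ) : ℝ) = 0 by push_cast; ring, Real.rpow_zero]

section Commutator

variable {τ α : ℝ} {x : E3}

theorem abs_cwtLog_le (hα : 0 < α) (hτ : 1 ≤ τ) (hx : x ≠ 0) (h1 : ‖x‖ ≤ 1) :
    |cwtLog τ α (α / 2) x| ≤ 2 * α * τ * wt α x := by
  have hr : 0 < ‖x‖ := norm_pos_iff.2 hx
  have hW := one_le_wt_mul_sq hα hx h1
  have hn : ‖x‖ ^ (-2 : ℝ) ≤ wt α x := by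
    rw [norm_rpow_neg_two, div_le_iff₀ (by positivity)]; exact hW
  have hn0 : 0 ≤ ‖x‖ ^ (-2 : ℝ) := by positivity
  have hW0 := wt_nonneg α x
  have h2 : α * (‖x‖ ^ (-2 : ℝ)) ≤ α * (τ * wt α x) := by
    gcongr; nlinarith
  have h3 : 0 ≤ τ * α * wt α x := by positivity
  have h4 : 0 ≤ α * ‖x‖ ^ (-2 : ℝ) := by positivity
  rw [cwtLog, abs_le]
  constructor <;> nlinarith

theorem abs_cwtLogD_mul_sq_le (hα : 0 < α) (hτ : 1 ≤ τ) (hx : x ≠ 0) (h1 : ‖x‖ ≤ 1) :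
    |cwtLogD τ α (α / 2) x| * ‖x‖ ^ 2 ≤ α * (α + 3) * τ * wt α x := by
  have hr : 0 < ‖x‖ := norm_pos_iff.2 hx
  have hW := one_le_wt_mul_sq hα hx h1
  have hn : ‖x‖ ^ (-2 : ℝ) ≤ wt α x := by
    rw [norm_rpow_neg_two, div_le_iff₀ (by positivity)]; exact hW
  have hn1 : ‖x‖ ^ (-2 : ℝ) * ‖x‖ ^ 2 = 1 := by
    rw [norm_rpow_neg_two]; field_simp
  have hn0 : 0 ≤ ‖x‖ ^ (-2 : ℝ) := by positivity
  have hW0 := wt_nonneg α x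
  have h2 : α * (‖x‖ ^ (-2 : ℝ)) ≤ α * (τ * wt α x) := by
    gcongr; nlinarith
  have h3 : 0 ≤ τ * α * wt α x := by positivity
  have h4 : 0 ≤ α * ‖x‖ ^ (-2 : ℝ) := by positivity
  rw [← abs_of_nonneg (sq_nonneg ‖x‖), ← abs_mul]
  have e : cwtLogD τ α (α / 2) x * ‖x‖ ^ 2
      = τ * α * (α + 2) * wt α x - α * ‖x‖ ^ (-2 : ℝ) := by
    rw [cwtLogD]
    linear_combination (τ * α * (α + 2) * wt α x - α * ‖x‖ ^ (-2 : ℝ)) * hn1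
  rw [e, abs_le]
  have : 0 ≤ τ * α * wt α x * (α + 2) := by positivity
  constructor <;> nlinarith

theorem abs_coord_le (x : E3) (i : Fin 3) : |x i| ≤ ‖x‖ := by
  simpa using PiLp.norm_apply_le x i

theorem sum_commutator_sq_le {u : E3 → ℝ} (hα : 0 < α) (hτ : 1 ≤ τ) (hx : x ≠ 0) (h1 : ‖x‖ ≤ 1)
    (hu : ContDiff ℝ (⊤ : ℕ∞) u) :
    ∑ j, ∑ k, (pd j (pd k (fun y => cwt τ α (α / 2) y * u y)) x
        - cwt τ α (α / 2) x * pd j (pd k u) x) ^ 2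
      ≤ commConst α * τ * carlemanEnergy τ α u x := by
  have hL := abs_cwtLog_le hα hτ hx h1
  have hD := abs_cwtLogD_mul_sq_le hα hτ hx h1
  have hG := cwt_sq_eq hx τ α
  have hP := rpow_mul_wt_mul_sq hx α
  have hW1 := one_le_wt_mul_sq hα hx h1
  have hW0 := wt_nonneg α x
  set K := 4 * α ^ 2 + α * (α + 3) + 2 * α with hK
  have hK0 : 0 ≤ K := by positivity
  set W := wt α x
  set L := cwtLog τ α (α / 2) x
  set D := cwtLogD τ α (α / 2) x
  set E := cwt τ α 0 x
  set G := cwt τ α (α / 2) x with hGdef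
  set r := ‖x‖ with hr
  have hr0 : 0 ≤ r := norm_nonneg _
  have hττ : τ * W ≤ τ ^ 2 * W ^ 2 * r ^ 2 := by
    have : τ * W * 1 ≤ τ * W * (τ * (W * r ^ 2)) := by
      gcongr; nlinarith
    linarith
  have hxx (j k) : |x j * x k| ≤ r ^ 2 := by
    rw [abs_mul, sq]; exact mul_le_mul (abs_coord_le x j) (abs_coord_le x k) (abs_nonneg _) hr0
  have hcoef (j k : Fin 3) : |(L ^ 2 + D) * (x j * x k) + L * (if j = k then 1 else 0)|
      ≤ K * (τ ^ 2 * W ^ 2 * r ^ 2) := by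
    have b1 : |L ^ 2 * (x j * x k)| ≤ (2 * α * τ * W) ^ 2 * r ^ 2 := by
      rw [abs_mul, abs_pow]; gcongr; exact hxx j k
    have b2 : |D * (x j * x k)| ≤ α * (α + 3) * (τ * W) := by
      rw [abs_mul]
      calc |D| * |x j * x k| ≤ |D| * r ^ 2 := by gcongr; exact hxx j k
        _ ≤ _ := by linarith
    have b3 : |L * (if j = k then 1 else 0)| ≤ 2 * α * (τ * W) := by
      split_ifs
      · simpa [mul_assoc] using hL
      · simp; positivity
    have b4 := abs_add_le (L ^ 2 * (x j * x k) + D * (x j * x k)) (L * (if j = k then 1 else 0))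
    have b5 := abs_add_le (L ^ 2 * (x j * x k)) (D * (x j * x k))
    have b6 : α * (α + 3) * (τ * W) ≤ α * (α + 3) * (τ ^ 2 * W ^ 2 * r ^ 2) := by gcongr
    have b7 : 2 * α * (τ * W) ≤ 2 * α * (τ ^ 2 * W ^ 2 * r ^ 2) := by gcongr
    rw [add_mul (L ^ 2)]
    nlinarith
  have hone (j k : Fin 3) : (pd j (pd k (fun y => cwt τ α (α / 2) y * u y)) x
        - G * pd j (pd k u) x) ^ 2 ≤ 3 * E ^ 2 * (4 * α ^ 2 * τ ^ 2 * W * (pd k u x ^ 2 + pd j u x ^ 2)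
          + K ^ 2 * τ ^ 4 * W ^ 3 * r ^ 2 * u x ^ 2) := by
    rw [pd_pd_cwt_mul hu hx j k]
    have q1 (m n) : (L * (x m * pd n u x)) ^ 2 ≤ (2 * α * τ * W) ^ 2 * (r ^ 2 * pd n u x ^ 2) := by
      rw [mul_pow, mul_pow, ← sq_abs L, ← sq_abs (x m)]
      gcongr; exact abs_coord_le x m
    have q2 : (((L ^ 2 + D) * (x j * x k) + L * (if j = k then 1 else 0)) * u x) ^ 2
        ≤ (K * (τ ^ 2 * W ^ 2 * r ^ 2)) ^ 2 * u x ^ 2 := by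
      rw [mul_pow, ← sq_abs (_ + _)]
      gcongr; exact hcoef j k
    have q3 (a b c : ℝ) : (a + b + c) ^ 2 ≤ 3 * (a ^ 2 + b ^ 2 + c ^ 2) := by
      nlinarith [sq_nonneg (a - b), sq_nonneg (b - c), sq_nonneg (a - c)]
    have q4 := q3 (L * (x j * pd k u x)) (L * (x k * pd j u x))
      (((L ^ 2 + D) * (x j * x k) + L * (if j = k then 1 else 0)) * u x)
    calc _ = G ^ 2 * (L * (x j * pd k u x) + L * (x k * pd j u x)
          + ((L ^ 2 + D) * (x j * x k) + L * (if j = k then 1 else 0)) * u x) ^ 2 := by ring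
      _ ≤ G ^ 2 * (3 * ((2 * α * τ * W) ^ 2 * (r ^ 2 * pd k u x ^ 2)
          + (2 * α * τ * W) ^ 2 * (r ^ 2 * pd j u x ^ 2)
          + (K * (τ ^ 2 * W ^ 2 * r ^ 2)) ^ 2 * u x ^ 2)) := by
          gcongr; linarith [q1 j k, q1 k j]
      _ = _ := by
          rw [hG]
          linear_combination 3 * E ^ 2 * (4 * α ^ 2 * τ ^ 2 * W * (pd k u x ^ 2 + pd j u x ^ 2)
            + K ^ 2 * τ ^ 4 * W ^ 3 * r ^ 2 * u x ^ 2) * hP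
  refine (Finset.sum_le_sum fun j _ => Finset.sum_le_sum fun k _ => hone j k).trans ?_
  rw [carlemanEnergy, commConst, ← hK]
  have hS : 0 ≤ E ^ 2 * τ ^ 2 * W * ∑ i, pd i u x ^ 2 :=
    mul_nonneg (by positivity) (Finset.sum_nonneg fun _ _ => sq_nonneg _)
  have hZ : 0 ≤ E ^ 2 * τ ^ 4 * W ^ 3 * r ^ 2 * u x ^ 2 := by positivity
  simp only [Fin.sum_univ_three] at hS ⊢
  change _ ≤ (72 * α ^ 2 + 27 * K ^ 2) * τ * (E ^ 2 * (τ * W * _ + τ ^ 3 * W ^ 3 * r ^ 2 * _))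
  nlinarith [mul_nonneg (sq_nonneg K) hS, mul_nonneg (sq_nonneg α) hZ]

end Commutator

theorem sum_sum_mul_sq_le {b w : Fin 3 → Fin 3 → ℝ} {B : ℝ} (hb : ∀ j k, |b j k| ≤ B) :
    (∑ j, ∑ k, b j k * w j k) ^ 2 ≤ 9 * B ^ 2 * ∑ j, ∑ k, w j k ^ 2 := by
  have h (f : Fin 3 → ℝ) : (∑ i, f i) ^ 2 ≤ 3 * ∑ i, f i ^ 2 := by
    simpa using sq_sum_le_card_mul_sum_sq (s := univ) (f := f)
  refine (h _).trans ?_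
  have h2 (j k) : (b j k * w j k) ^ 2 ≤ B ^ 2 * w j k ^ 2 := by
    rw [mul_pow, ← sq_abs (b j k)]
    gcongr; exact hb j k
  calc 3 * ∑ j, (∑ k, b j k * w j k) ^ 2 ≤ 3 * ∑ j, (3 * ∑ k, B ^ 2 * w j k ^ 2) := by
        gcongr with j
        exact (h _).trans (by gcongr with k; exact h2 j k)
    _ = _ := by 
        simp only [Finset.mul_sum]
        exact sum_congr rfl fun j _ => sum_congr rfl fun k _ => by ring

theorem integral_cwt_hessSq_le {a : Fin 3 → Fin 3 → E3 → ℝ} {α κ B c r₀ τ c₀ : ℝ} {u : E3 → ℝ}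
    (H : CoefBounds a α κ B c r₀) (hτ : 1 ≤ τ) (hc₀ : 0 ≤ c₀)
    (hell : ∀ ξ : Fin 3 → ℝ, c₀ * (∑ i, ξ i ^ 2) ≤ ∑ j, ∑ k, a j k 0 * ξ j * ξ k)
    (hclose : ∀ j k, ∀ x ∈ ball (0 : E3) r₀, |a j k 0 - a j k x| ≤ c₀ / 8)
    (hu : ContDiff ℝ (⊤ : ℕ∞) u) (hs : tsupport u ⊆ ball (0 : E3) r₀ \ {0}) :
    c₀ ^ 2 * ∫ x, cwt τ α (α / 2) x ^ 2 * hessSq u x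
      ≤ 12 * (∫ x, (cwt τ α 0 x * op2 a u x) ^ 2)
        + (108 * B ^ 2 + 2 * c₀ ^ 2) * (commConst α * τ) * ∫ x, carlemanEnergy τ α u x := by
  have hα := H.alpha_pos
  have h0 : (0 : E3) ∉ tsupport u := fun h => (hs h).2 rfl
  set ω : E3 → ℝ := fun y => cwt τ α (α / 2) y * u y with hω
  have hωs : ContDiff ℝ (⊤ : ℕ∞) ω := contDiff_cwt_mul hu h0
  have hωt : tsupport ω ⊆ tsupport u := tsupport_mul_subset_right
  have hωc : HasCompactSupport ω := (isCompact_tsupport_of_subset_ball hs).of_isClosed_subset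
    (isClosed_tsupport _) hωt
  have key := integral_hessian_sq_le (fun j k => H.symm j k 0) hc₀ hell hωs hωc
  have hM : 0 ≤ commConst α * τ := by unfold commConst; positivity
  have iE := integrable_carlemanEnergy (α := α) τ hu hs
  have iP := integrable_cwt_mul_op2_sq H τ 0 hu hs
  have iω : Integrable fun x => ∑ j, ∑ k, pd j (pd k ω) x ^ 2 :=
    integrable_of_continuousOn isOpen_univ hωc (Set.subset_univ _)
      (continuousOn_finsetSum _ fun j _ => continuousOn_finsetSum _ fun k _ =>
        ((hωs.pd k).pd j).continuous.continuousOn.pow 2) fun x hx => by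
      simp [pd_pd_eq_zero_of_notMem_tsupport hx]
  have hzero {x : E3} (hx : x ∉ tsupport u) (j k) : pd j (pd k ω) x = 0 :=
    pd_pd_eq_zero_of_notMem_tsupport (fun h => hx (hωt h)) j k
  have hq3 (a b c : ℝ) : (a + b + c) ^ 2 ≤ 3 * (a ^ 2 + b ^ 2 + c ^ 2) := by
    nlinarith [sq_nonneg (a - b), sq_nonneg (b - c), sq_nonneg (a - c)]
  have i1 : ∫ x, (∑ j, ∑ k, a j k 0 * pd j (pd k ω) x) ^ 2
      ≤ ∫ x, (3 * (cwt τ α 0 x * op2 a u x) ^ 2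
        + 27 * B ^ 2 * (commConst α * τ) * carlemanEnergy τ α u x
        + c₀ ^ 2 / 2 * ∑ j, ∑ k, pd j (pd k ω) x ^ 2) := by
    refine integral_mono_of_nonneg (ae_of_all _ fun x => sq_nonneg _)
      (((iP.const_mul 3).add (iE.const_mul _)).add (iω.const_mul _)) (ae_of_all _ fun x => ?_)
    have hen := carlemanEnergy_nonneg (zero_le_one.trans hτ) α u x
    have hω2 : 0 ≤ ∑ j, ∑ k, pd j (pd k ω) x ^ 2 := hessSq_nonneg ω x
    by_cases hx : x ∈ tsupport u
    · have hxb := (hs hx).1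
      have hx1 : ‖x‖ ≤ 1 := (mem_ball_zero_iff.1 hxb).le.trans H.r_le
      have hcomm := sum_commutator_sq_le hα hτ (hs hx).2 hx1 hu
      have s1 := sum_sum_mul_sq_le (w := fun j k => pd j (pd k ω) x
        - cwt τ α (α / 2) x * pd j (pd k u) x) (fun j k => H.bound j k x hxb)
      have s2 := sum_sum_mul_sq_le (w := fun j k => pd j (pd k ω) x)
        (fun j k => hclose j k x hxb)
      have s3 : (cwt τ α (α / 2) x * op2 a u x) ^ 2 ≤ (cwt τ α 0 x * op2 a u x) ^ 2 := by
        rw [mul_pow, mul_pow, cwt_sq_eq (hs hx).2]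
        have : ‖x‖ ^ α ≤ 1 := Real.rpow_le_one (norm_nonneg _) hx1 hα.le
        gcongr
        exact mul_le_of_le_one_right (sq_nonneg _) this
      have e : ∑ j, ∑ k, a j k 0 * pd j (pd k ω) x = cwt τ α (α / 2) x * op2 a u x
          + (∑ j, ∑ k, a j k x * (pd j (pd k ω) x - cwt τ α (α / 2) x * pd j (pd k u) x))
          + ∑ j, ∑ k, (a j k 0 - a j k x) * pd j (pd k ω) x := by
        simp only [op2, Fin.sum_univ_three]; ring
      change (∑ j, ∑ k, a j k 0 * pd j (pd k ω) x) ^ 2 ≤ _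
      rw [e]
      have t1 := mul_le_mul_of_nonneg_left hcomm (by positivity : 0 ≤ 27 * B ^ 2)
      have t2 : 0 ≤ c₀ ^ 2 * ∑ j, ∑ k, pd j (pd k ω) x ^ 2 := by positivity
      refine (hq3 _ _ _).trans ?_
      change _ ≤ 3 * (cwt τ α 0 x * op2 a u x) ^ 2
        + 27 * B ^ 2 * (commConst α * τ) * carlemanEnergy τ α u x
        + c₀ ^ 2 / 2 * ∑ j, ∑ k, pd j (pd k ω) x ^ 2
      linarith
    · simp only [hzero hx, mul_zero, Finset.sum_const_zero]
      have : 0 ≤ 27 * B ^ 2 * (commConst α * τ) * carlemanEnergy τ α u x := by positivity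
      norm_num
      positivity
  have i2 : ∫ x, cwt τ α (α / 2) x ^ 2 * hessSq u x
      ≤ ∫ x, (2 * (∑ j, ∑ k, pd j (pd k ω) x ^ 2)
        + 2 * (commConst α * τ) * carlemanEnergy τ α u x) := by
    refine integral_mono_of_nonneg (ae_of_all _ fun x => mul_nonneg (sq_nonneg _)
      (hessSq_nonneg _ _)) ((iω.const_mul _).add (iE.const_mul _)) (ae_of_all _ fun x => ?_)
    have hen := carlemanEnergy_nonneg (zero_le_one.trans hτ) α u x
    have hω2 : 0 ≤ ∑ j, ∑ k, pd j (pd k ω) x ^ 2 := hessSq_nonneg ω x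
    by_cases hx : x ∈ tsupport u
    · have hx1 : ‖x‖ ≤ 1 := (mem_ball_zero_iff.1 (hs hx).1).le.trans H.r_le
      have hcomm := sum_commutator_sq_le hα hτ (hs hx).2 hx1 hu
      have : cwt τ α (α / 2) x ^ 2 * hessSq u x ≤ ∑ j, ∑ k, (2 * pd j (pd k ω) x ^ 2
          + 2 * (pd j (pd k ω) x - cwt τ α (α / 2) x * pd j (pd k u) x) ^ 2) := by
        rw [hessSq, Finset.mul_sum]
        refine Finset.sum_le_sum fun j _ => ?_
        rw [Finset.mul_sum]
        refine Finset.sum_le_sum fun k _ => ?_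
        nlinarith [sq_nonneg (2 * pd j (pd k ω) x - cwt τ α (α / 2) x * pd j (pd k u) x)]
      simp only [Finset.sum_add_distrib, ← Finset.mul_sum] at this
      change cwt τ α (α / 2) x ^ 2 * hessSq u x ≤ 2 * (∑ j, ∑ k, pd j (pd k ω) x ^ 2)
        + 2 * (commConst α * τ) * carlemanEnergy τ α u x
      linarith
    · change cwt τ α (α / 2) x ^ 2 * hessSq u x ≤ 2 * (∑ j, ∑ k, pd j (pd k ω) x ^ 2)
        + 2 * (commConst α * τ) * carlemanEnergy τ α u x
      have e : hessSq u x = 0 := by simp [hessSq, pd_pd_eq_zero_of_notMem_tsupport hx]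
      rw [e, mul_zero]; positivity
  rw [integral_add ((iP.const_mul 3).fun_add (iE.const_mul _)) (iω.const_mul _),
    integral_add (iP.const_mul 3) (iE.const_mul _)] at i1
  rw [integral_add (iω.const_mul _) (iE.const_mul _)] at i2
  simp only [integral_const_mul] at i1 i2
  have := mul_le_mul_of_nonneg_left i2 (sq_nonneg c₀)
  linarith

section Spectral

variable {A : Matrix (Fin 3) (Fin 3) ℝ}

/-- The quadratic forms of `A` and `A²` in an eigenbasis of `A`. -/
theorem exists_diagonal_coords (h : A.IsHermitian) (p : Fin 3 → ℝ) : ∃ y : Fin 3 → ℝ,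
    ∑ i, p i ^ 2 = ∑ i, y i ^ 2 ∧
    ∑ j, ∑ k, A j k * p j * p k = ∑ i, h.eigenvalues i * y i ^ 2 ∧
    ∑ i, (∑ k, A i k * p k) ^ 2 = ∑ i, h.eigenvalues i ^ 2 * y i ^ 2 := by
  set b := h.eigenvectorBasis
  set ξ : E3 := WithLp.toLp 2 p
  set η : E3 := WithLp.toLp 2 (A.mulVec p)
  have hη (i) : inner ℝ (b i) η = h.eigenvalues i * inner ℝ (b i) ξ := by
    have h1 : inner ℝ (b i) η = A.mulVec p ⬝ᵥ (b i).ofLp := by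
      simp [η, EuclideanSpace.inner_eq_star_dotProduct]
    have h2 : inner ℝ (b i) ξ = p ⬝ᵥ (b i).ofLp := by
      simp [ξ, EuclideanSpace.inner_eq_star_dotProduct]
    have hT : A.transpose = A := by
      simpa [Matrix.conjTranspose_eq_transpose_of_trivial] using h.eq
    rw [h1, h2, dotProduct_comm, Matrix.dotProduct_mulVec, ← Matrix.mulVec_transpose, hT,
      h.mulVec_eigenvectorBasis, smul_dotProduct, smul_eq_mul, dotProduct_comm]
  have hp (u v : E3) := b.sum_inner_mul_inner u v
  refine ⟨fun i => inner ℝ (b i) ξ, ?_, ?_, ?_⟩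
  · have := hp ξ ξ
    rw [PiLp.inner_apply] at this
    simp only [real_inner_comm (b _) ξ, ξ, RCLike.inner_apply, conj_trivial, ← sq] at this
    exact this.symm
  · have := hp ξ η
    rw [PiLp.inner_apply] at this
    simp only [hη, real_inner_comm (b _) ξ] at this
    simp only [ξ, η, RCLike.inner_apply, conj_trivial, Matrix.mulVec, dotProduct] at this
    calc _ = ∑ j, (∑ k, A j k * p k) * p j := by
          simp only [Finset.sum_mul]
          exact sum_congr rfl fun j _ => sum_congr rfl fun k _ => by ring
      _ = _ := this.symm.trans (sum_congr rfl fun i _ => by ring)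
  · have := hp η η
    rw [PiLp.inner_apply] at this
    simp only [real_inner_comm (b _) η, hη] at this
    simp only [ξ, η, RCLike.inner_apply, conj_trivial, Matrix.mulVec, dotProduct] at this
    calc _ = ∑ j, (∑ k, A j k * p k) * (∑ k, A j k * p k) := sum_congr rfl fun j _ => sq _
      _ = _ := this.symm.trans (sum_congr rfl fun i _ => by ring)

theorem eigenvalues_pos_of_elliptic (h : A.IsHermitian) {c₀ : ℝ} (hc₀ : 0 < c₀)
    (hell : ∀ ξ : Fin 3 → ℝ, c₀ * (∑ i, ξ i ^ 2) ≤ ∑ j, ∑ k, A j k * ξ j * ξ k) (i : Fin 3) :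
    0 < h.eigenvalues i := by
  refine Matrix.PosDef.eigenvalues_pos (A := A) ?_ i
  refine Matrix.PosDef.of_dotProduct_mulVec_pos h fun {p} hp => ?_
  have h1 : 0 < ∑ i, p i ^ 2 := by
    obtain ⟨j, hj⟩ := Function.ne_iff.1 hp
    exact Finset.sum_pos' (fun _ _ => sq_nonneg _) ⟨j, mem_univ _, by
      have : p j ≠ 0 := hj
      positivity⟩
  refine (mul_pos hc₀ h1).trans_le ((hell p).trans_eq ?_)
  simp only [star_trivial, dotProduct, Matrix.mulVec, Finset.mul_sum]
  exact sum_congr rfl fun j _ => sum_congr rfl fun k _ => by ring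

theorem exists_multiplier_constant (h : A.IsHermitian) {α : ℝ}
    (hpos : ∀ i, 0 < h.eigenvalues i)
    (heig : ∀ i j, (h.eigenvalues i - h.eigenvalues j) / h.eigenvalues j < α) :
    ∃ κ > 0, ∃ c > 0, ∀ p : Fin 3 → ℝ,
      c * ∑ i, p i ^ 2 ≤ κ * (∑ j, ∑ k, A j k * p j * p k) - ∑ i, (∑ k, A i k * p k) ^ 2 ∧
      c * (∑ i, p i ^ 2) ^ 2 ≤ (α + 2) * (∑ j, ∑ k, A j k * p j * p k) ^ 2
        - (∑ i, (∑ k, A i k * p k) ^ 2) * (∑ i, p i ^ 2)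
        - κ * (∑ j, ∑ k, A j k * p j * p k) * (∑ i, p i ^ 2) := by
  obtain ⟨i₁, hi₁⟩ := Finite.exists_min h.eigenvalues
  obtain ⟨i₃, hi₃⟩ := Finite.exists_max h.eigenvalues
  set m := h.eigenvalues i₁
  set M := h.eigenvalues i₃
  have hm : 0 < m := hpos i₁
  have hM : 0 < M := hpos i₃
  have hmM : (M - m) / m < α := heig i₃ i₁
  set β := α - (M - m) / m with hβ
  have hβ0 : 0 < β := sub_pos.2 hmM
  have hαm : (α + 2) * m = m + M + β * m := by
    rw [hβ]; field_simp; ring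
  refine ⟨M + β * m / 2, by positivity, β * m ^ 2 / 2, by positivity, fun p => ?_⟩
  obtain ⟨y, h1, h2, h3⟩ := exists_diagonal_coords h p
  rw [h1, h2, h3]
  have hS : 0 ≤ ∑ i, y i ^ 2 := Finset.sum_nonneg fun _ _ => sq_nonneg _
  have hq : m * ∑ i, y i ^ 2 ≤ ∑ i, h.eigenvalues i * y i ^ 2 := by
    rw [Finset.mul_sum]; gcongr with i; exact hi₁ i
  have hN : ∑ i, h.eigenvalues i ^ 2 * y i ^ 2 ≤ M * ∑ i, h.eigenvalues i * y i ^ 2 := by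
    rw [Finset.mul_sum]
    refine Finset.sum_le_sum fun i _ => ?_
    nlinarith [mul_nonneg (mul_nonneg (hpos i).le (sub_nonneg.2 (hi₃ i))) (sq_nonneg (y i))]
  have hN' : ∑ i, h.eigenvalues i ^ 2 * y i ^ 2
      ≤ (m + M) * (∑ i, h.eigenvalues i * y i ^ 2) - m * M * ∑ i, y i ^ 2 := by
    rw [Finset.mul_sum, Finset.mul_sum, ← Finset.sum_sub_distrib]
    refine Finset.sum_le_sum fun i _ => ?_
    nlinarith [mul_nonneg (mul_nonneg (sub_nonneg.2 (hi₁ i)) (sub_nonneg.2 (hi₃ i)))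
      (sq_nonneg (y i))]
  set S := ∑ i, y i ^ 2
  set q := ∑ i, h.eigenvalues i * y i ^ 2
  set N := ∑ i, h.eigenvalues i ^ 2 * y i ^ 2
  have hq0 : 0 ≤ q := (mul_nonneg hm.le hS).trans hq
  constructor
  · have := mul_le_mul_of_nonneg_left hq (by positivity : 0 ≤ β * m / 2)
    nlinarith
  · have e1 : 0 ≤ (q - m * S) * ((m + M) * q - m * M * S) := by
      refine mul_nonneg (sub_nonneg.2 hq) ?_
      nlinarith [mul_le_mul_of_nonneg_left hq hM.le]
    have e2 := mul_le_mul_of_nonneg_right hN' hS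
    have e3 : 0 ≤ β * m / 2 * ((q - m * S) * q) := by
      have := sub_nonneg.2 hq; positivity
    have e4 : 0 ≤ β * m / 2 * ((q - m * S) * (q + m * S)) := by
      have := sub_nonneg.2 hq; positivity
    refine le_of_mul_le_mul_left ?_ hm
    have e5 : m * ((α + 2) * q ^ 2) = (m + M + β * m) * q ^ 2 := by rw [← hαm]; ring
    have e6 := mul_le_mul_of_nonneg_left e2 hm.le
    nlinarith

end Spectral

section Perturbation

variable {A A' : Fin 3 → Fin 3 → ℝ} {B δ : ℝ}

theorem abs_quadratic_le {D : Fin 3 → Fin 3 → ℝ} (hD : ∀ j k, |D j k| ≤ δ) (p : Fin 3 → ℝ) :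
    |∑ j, ∑ k, D j k * p j * p k| ≤ 9 * δ * ∑ i, p i ^ 2 := by
  have h (j k) : |D j k * p j * p k| ≤ δ * ∑ i, p i ^ 2 := by
    rw [mul_assoc]; exact abs_mul_le_mul (hD j k) (abs_mul_le_sum_sq p j k)
  refine (abs_sum_fin_three_le fun j => abs_sum_fin_three_le fun k => h j k).trans_eq ?_
  ring

theorem abs_quadratic_sub_le (h : ∀ j k, |A' j k - A j k| ≤ δ) (p : Fin 3 → ℝ) :
    |(∑ j, ∑ k, A' j k * p j * p k) - ∑ j, ∑ k, A j k * p j * p k| ≤ 9 * δ * ∑ i, p i ^ 2 := by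
  have := abs_quadratic_le h p
  simpa only [sub_mul, Finset.sum_sub_distrib] using this

theorem abs_mulVec_sq_sub_le (hA : ∀ j k, |A j k| ≤ B) (hA' : ∀ j k, |A' j k| ≤ B)
    (h : ∀ j k, |A' j k - A j k| ≤ δ) (p : Fin 3 → ℝ) :
    |(∑ i, (∑ k, A' i k * p k) ^ 2) - ∑ i, (∑ k, A i k * p k) ^ 2|
      ≤ 54 * B * δ * ∑ i, p i ^ 2 := by
  have h1 (i j k) : |(A' i j - A i j) * (A' i k + A i k)| ≤ δ * (2 * B) :=
    abs_mul_le_mul (h i j) ((abs_add_le _ _).trans (by linarith [hA i k, hA' i k]))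
  have e : (∑ i, (∑ k, A' i k * p k) ^ 2) - ∑ i, (∑ k, A i k * p k) ^ 2
      = ∑ i, ∑ j, ∑ k, (A' i j - A i j) * (A' i k + A i k) * p j * p k := by
    simp only [Fin.sum_univ_three]; ring
  rw [e]
  refine (abs_sum_fin_three_le fun i => abs_quadratic_le (h1 i) p).trans_eq ?_
  ring

theorem gradient_radial_perturbation {α κ c : ℝ} (hα : 0 ≤ α) (hκ : 0 ≤ κ) (hδ : 0 ≤ δ)
    (hsmall : δ * ((9 + 54 * B) * ((α + 2) * 18 * B + 1 + κ)) ≤ c / 2)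
    (hA : ∀ j k, |A j k| ≤ B) (hA' : ∀ j k, |A' j k| ≤ B)
    (h : ∀ j k, |A' j k - A j k| ≤ δ) {p : Fin 3 → ℝ}
    (hp : c * ∑ i, p i ^ 2 ≤ κ * (∑ j, ∑ k, A j k * p j * p k) - ∑ i, (∑ k, A i k * p k) ^ 2 ∧
      c * (∑ i, p i ^ 2) ^ 2 ≤ (α + 2) * (∑ j, ∑ k, A j k * p j * p k) ^ 2
        - (∑ i, (∑ k, A i k * p k) ^ 2) * (∑ i, p i ^ 2)
        - κ * (∑ j, ∑ k, A j k * p j * p k) * (∑ i, p i ^ 2)) :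
    c / 2 * ∑ i, p i ^ 2
        ≤ κ * (∑ j, ∑ k, A' j k * p j * p k) - ∑ i, (∑ k, A' i k * p k) ^ 2 ∧
      c / 2 * (∑ i, p i ^ 2) ^ 2 ≤ (α + 2) * (∑ j, ∑ k, A' j k * p j * p k) ^ 2
        - (∑ i, (∑ k, A' i k * p k) ^ 2) * (∑ i, p i ^ 2)
        - κ * (∑ j, ∑ k, A' j k * p j * p k) * (∑ i, p i ^ 2) := by
  have hB : 0 ≤ B := (abs_nonneg _).trans (hA 0 0)
  have hS : 0 ≤ ∑ i, p i ^ 2 := Finset.sum_nonneg fun _ _ => sq_nonneg _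
  have bq := abs_quadratic_sub_le h p
  have bN := abs_mulVec_sq_sub_le hA hA' h p
  have b1 := abs_quadratic_le hA p
  have b2 := abs_quadratic_le hA' p
  obtain ⟨hp1, hp2⟩ := hp
  set S := ∑ i, p i ^ 2
  set q := ∑ j, ∑ k, A j k * p j * p k
  set q' := ∑ j, ∑ k, A' j k * p j * p k
  set N := ∑ i, (∑ k, A i k * p k) ^ 2
  set N' := ∑ i, (∑ k, A' i k * p k) ^ 2
  obtain ⟨η, hη⟩ : ∃ η, η = (9 + 54 * B) * δ := ⟨_, rfl⟩
  have hη0 : 0 ≤ η := by rw [hη]; positivity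
  have hs : η * ((α + 2) * 18 * B + 1 + κ) ≤ c / 2 := by rw [hη]; linarith
  have hs' := mul_le_mul_of_nonneg_right hs hS
  have hq : |q' - q| ≤ η * S := bq.trans (by
    rw [hη]; gcongr; nlinarith [mul_nonneg hB hδ])
  have hN : |N' - N| ≤ η * S := bN.trans (by
    rw [hη]; gcongr; nlinarith [mul_nonneg hB hδ])
  have hqq : |(q' - q) * (q' + q)| ≤ η * S * (18 * B * S) :=
    abs_mul_le_mul hq ((abs_add_le _ _).trans (by linarith))
  have k1 := mul_le_mul_of_nonneg_left (abs_le.1 hq).1 hκ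
  have k2 := mul_le_mul_of_nonneg_left (abs_le.1 hqq).1 (by linarith : 0 ≤ α + 2)
  have k3 := mul_le_mul_of_nonneg_right (abs_le.1 hN).2 hS
  have k4 := mul_le_mul_of_nonneg_left (abs_le.1 hq).2 hκ
  have k5 := mul_le_mul_of_nonneg_right k4 hS
  have k6 := mul_le_mul_of_nonneg_right hs' hS
  have k7 : 0 ≤ η * ((α + 2) * 18 * B) * S := by positivity
  constructor
  · nlinarith [(abs_le.1 hN).2]
  · nlinarith

end Perturbation

/-- Near the origin, an operator with positive definite principal part at the origin whose
eigenvalues are pinched satisfies the bounds needed for the Carleman estimate. -/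
theorem exists_coefBounds {Ω : Set E3} (hΩ : IsOpen Ω) (h0 : (0 : E3) ∈ Ω) {α : ℝ} (hα : 0 < α)
    {a : Fin 3 → Fin 3 → E3 → ℝ} (hsym : ∀ j k x, a j k x = a k j x)
    (hsm : ∀ j k, ContDiffOn ℝ (⊤ : ℕ∞) (a j k) Ω) {B : ℝ}
    (hB : ∀ j k, ∀ x ∈ Ω, |a j k x| ≤ B) (hB' : ∀ l j k, ∀ x ∈ Ω, |pd l (a j k) x| ≤ B)
    {c₀ : ℝ} (hc₀ : 0 < c₀)
    (hell : ∀ ξ : Fin 3 → ℝ, c₀ * (∑ i, ξ i ^ 2) ≤ ∑ j, ∑ k, a j k 0 * ξ j * ξ k)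
    (heig : EigCond a α) :
    ∃ κ c r₀, CoefBounds a α κ B c r₀ ∧
      ∀ j k, ∀ x ∈ ball (0 : E3) r₀, |a j k 0 - a j k x| ≤ c₀ / 8 := by
  have hH : (coefMatrix a 0).IsHermitian := by
    ext j k; simp [coefMatrix, hsym j k]
  obtain ⟨κ, hκ, c, hc, hp⟩ := exists_multiplier_constant hH
    (eigenvalues_pos_of_elliptic hH hc₀ hell) (heig hH)
  simp only [coefMatrix, Matrix.of_apply] at hp
  have hB0 : 0 ≤ B := (abs_nonneg _).trans (hB 0 0 0 h0)
  set K := (9 + 54 * B) * ((α + 2) * 18 * B + 1 + κ) with hK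
  have hK0 : 0 < K := by positivity
  set δ := min (c₀ / 8) (c / 2 / K) with hδ
  have hδ0 : 0 < δ := by positivity
  have hδK : δ * K ≤ c / 2 := (le_div_iff₀ hK0).1 (min_le_right _ _)
  have hev : ∀ᶠ x in nhds (0 : E3), x ∈ Ω ∧ ∀ j k, |a j k x - a j k 0| ≤ δ := by
    refine (hΩ.eventually_mem h0).and (Filter.eventually_all.2 fun j =>
      Filter.eventually_all.2 fun k => ?_)
    have := ((hsm j k).continuousOn.continuousAt (hΩ.mem_nhds h0)).eventually
      (Metric.closedBall_mem_nhds _ hδ0)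
    simpa only [Metric.mem_closedBall, Real.dist_eq] using this
  obtain ⟨r, hr, hrb⟩ := Metric.eventually_nhds_iff_ball.1 hev
  refine ⟨κ, c / 2, min r (min 1 (c / 2 / 2 / (486 * B ^ 2 + 1))), ?_, ?_⟩
  · have hsub : ball (0 : E3) (min r (min 1 (c / 2 / 2 / (486 * B ^ 2 + 1)))) ⊆ ball 0 r :=
      ball_subset_ball (min_le_left _ _)
    refine ⟨hα, by positivity, by positivity, (min_le_right _ _).trans (min_le_left _ _), hsym,
      fun j k => (hsm j k).mono fun x hx => (hrb x (hsub hx)).1,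
      fun j k x hx => hB j k x (hrb x (hsub hx)).1,
      fun l j k x hx => hB' l j k x (hrb x (hsub hx)).1, fun x hx p => ?_, fun x hx p => ?_, ?_⟩
    · exact (gradient_radial_perturbation hα.le hκ.le hδ0.le hδK (fun j k => hB j k 0 h0)
        (fun j k => hB j k x (hrb x (hsub hx)).1) (hrb x (hsub hx)).2 (hp p)).1
    · exact (gradient_radial_perturbation hα.le hκ.le hδ0.le hδK (fun j k => hB j k 0 h0)
        (fun j k => hB j k x (hrb x (hsub hx)).1) (hrb x (hsub hx)).2 (hp p)).2
    · have h1 := (min_le_right r (min 1 (c / 2 / 2 / (486 * B ^ 2 + 1)))).trans (min_le_right _ _)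
      rw [le_div_iff₀ (by positivity)] at h1
      have : 0 < min r (min 1 (c / 2 / 2 / (486 * B ^ 2 + 1))) := by positivity
      nlinarith
  · intro j k x hx
    rw [abs_sub_comm]
    exact ((hrb x (ball_subset_ball (min_le_left _ _) hx)).2 j k).trans (min_le_left _ _)

theorem integrable_cwt_hessSq (τ α : ℝ) {r₀ : ℝ} {u : E3 → ℝ} (hu : ContDiff ℝ (⊤ : ℕ∞) u)
    (hs : tsupport u ⊆ ball (0 : E3) r₀ \ {0}) :
    Integrable fun x => cwt τ α (α / 2) x ^ 2 * hessSq u x := by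
  refine integrable_of_continuousOn (isOpen_puncturedBall r₀) (isCompact_tsupport_of_subset_ball hs)
    hs (((contDiffOn_cwt fun x hx => hx.2).continuousOn.pow 2).mul
      (continuousOn_finsetSum _ fun j _ => continuousOn_finsetSum _ fun k _ =>
        ((hu.pd k).pd j).continuous.continuousOn.pow 2)) fun x hx => ?_
  simp [hessSq, pd_pd_eq_zero_of_notMem_tsupport hx]

theorem GevreyOn.exists_bound {s : ℝ} {Ω : Set E3} {f : E3 → ℝ} (hf : GevreyOn s Ω f) :
    ∃ B, ∀ x ∈ Ω, |f x| ≤ B ∧ ∀ l, |pd l f x| ≤ B := by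
  obtain ⟨-, c, hc, A, hA, h⟩ := hf
  refine ⟨c + c * A, fun x hx => ⟨?_, fun l => ?_⟩⟩
  · have := h 0 x hx
    simp [mpd, mdeg] at this
    nlinarith [mul_pos hc hA]
  · have := h (Pi.single l 1) x hx
    have e : mpd (Pi.single l 1) f = pd l f := by
      fin_cases l <;> simp [mpd]
    have e' : mdeg (Pi.single l 1) = 1 := by
      fin_cases l <;> simp [mdeg]
    rw [e, e'] at this
    simp at this
    linarith

/-- The Carleman estimate for a single scalar operator. -/
theorem exists_carleman_scalar {Ω : Set E3} (hΩ : IsOpen Ω) (h0 : (0 : E3) ∈ Ω) {s α : ℝ}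
    (hα : 0 < α) {a : Fin 3 → Fin 3 → E3 → ℝ} (hsym : ∀ j k x, a j k x = a k j x)
    (hG : ∀ j k, GevreyOn s Ω (a j k)) (hell : UnifElliptic a Ω) (heig : EigCond a α) :
    ∃ τ₀ ≥ (1 : ℝ), ∃ r₀ > (0 : ℝ), ∃ C > (0 : ℝ), ∀ τ > τ₀, ∀ u : E3 → ℝ,
      ContDiff ℝ (⊤ : ℕ∞) u → tsupport u ⊆ ball (0 : E3) r₀ \ {0} →
        Integrable (fun x => (cwt τ α 0 x * op2 a u x) ^ 2) ∧
        (∫ x, carlemanEnergy τ α u x) + τ⁻¹ * ∫ x, cwt τ α (α / 2) x ^ 2 * hessSq u x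
          ≤ C * ∫ x, (cwt τ α 0 x * op2 a u x) ^ 2 := by
  choose Bf hBf using fun j k => (hG j k).exists_bound
  have hB (j k) : Bf j k ≤ ∑ j, ∑ k, |Bf j k| := (le_abs_self _).trans
    ((Finset.single_le_sum (f := fun k => |Bf j k|) (fun _ _ => abs_nonneg _) (mem_univ k)).trans
      (Finset.single_le_sum (f := fun j => ∑ k, |Bf j k|)
        (fun _ _ => Finset.sum_nonneg fun _ _ => abs_nonneg _) (mem_univ j)))
  set B := ∑ j, ∑ k, |Bf j k|
  obtain ⟨c₀, hc₀, hell⟩ := hell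
  obtain ⟨κ, c, r₀, H, hclose⟩ := exists_coefBounds hΩ h0 hα hsym (fun j k => (hG j k).1)
    (fun j k x hx => (hBf j k x hx).1.trans (hB j k))
    (fun l j k x hx => ((hBf j k x hx).2 l).trans (hB j k)) hc₀ (hell 0 h0) heig
  have hc := H.c_pos
  set m := min (α * c / 8) (α ^ 3 * c / 4) with hm
  have hm0 : 0 < m := by positivity
  set Q := (108 * B ^ 2 + 2 * c₀ ^ 2) * commConst α with hQ
  have hQ0 : 0 ≤ Q := by unfold Q commConst; positivity
  set K := crossConst α κ B
  refine ⟨1 + 27 * K ^ 2 / (α ^ 4 * c ^ 2) + 4 * κ ^ 2 / (α * c), ?_, r₀, H.r_pos,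
    1 / (2 * m) + 12 / c₀ ^ 2 + Q / c₀ ^ 2 * (1 / (2 * m)), by positivity,
    fun τ hτ u hu hs => ⟨integrable_cwt_mul_op2_sq H τ 0 hu hs, ?_⟩⟩
  · have : 0 ≤ 27 * K ^ 2 / (α ^ 4 * c ^ 2) := by positivity
    have : 0 ≤ 4 * κ ^ 2 / (α * c) := by positivity
    linarith
  have p1 : 0 ≤ 27 * K ^ 2 / (α ^ 4 * c ^ 2) := by positivity
  have p2 : 0 ≤ 4 * κ ^ 2 / (α * c) := by positivity
  have hτ1 : 1 ≤ τ := by linarith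
  have hτ' : 27 * K ^ 2 ≤ α ^ 4 * c ^ 2 * τ ^ 2 := by
    rw [mul_comm (α ^ 4 * c ^ 2), ← div_le_iff₀ (by positivity)]
    nlinarith
  have hτκ : 4 * κ ^ 2 ≤ α * c * τ := by
    rw [mul_comm (α * c), ← div_le_iff₀ (by positivity)]
    linarith
  have e1 := integral_carlemanEnergy_le H (by linarith) hτ' hτκ hu hs
  have e2 := integral_cwt_hessSq_le H hτ1 hc₀.le (hell 0 h0) hclose hu hs
  set I := ∫ x, (cwt τ α 0 x * op2 a u x) ^ 2
  set J := ∫ x, carlemanEnergy τ α u x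
  have hI : 0 ≤ I := integral_nonneg fun _ => sq_nonneg _
  have e3 : J ≤ 1 / (2 * m) * I := by
    rw [div_mul_eq_mul_div, le_div_iff₀ (by positivity)]; linarith
  have e4 : τ⁻¹ * ∫ x, cwt τ α (α / 2) x ^ 2 * hessSq u x ≤ 12 / c₀ ^ 2 * I + Q / c₀ ^ 2 * J := by
    rw [inv_mul_le_iff₀ (by linarith)]
    refine le_of_mul_le_mul_left (e2.trans ?_) (by positivity : 0 < c₀ ^ 2)
    have : 12 * I * 1 ≤ 12 * I * τ := by gcongr
    calc _ ≤ 12 * I * τ + Q * τ * J := by rw [hQ]; linarith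
      _ = _ := by field_simp
  have e5 := mul_le_mul_of_nonneg_left e3 (by positivity : 0 ≤ Q / c₀ ^ 2)
  linarith

theorem fderiv_apply_eq_sum (f : E3 → ℝ) (x v : E3) : fderiv ℝ f x v = ∑ l, v l * pd l f x := by
  conv_lhs => rw [← (EuclideanSpace.basisFun (Fin 3) ℝ).sum_repr v, map_sum]
  simp [pd]

theorem fderiv_fderiv_apply_eq_sum {f : E3 → ℝ} (hf : ContDiff ℝ (⊤ : ℕ∞) f) (x v w : E3) :
    fderiv ℝ (fderiv ℝ f) x v w = ∑ j, v j * ∑ k, w k * pd j (pd k f) x := by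
  have hd : DifferentiableAt ℝ (fderiv ℝ f) x :=
    (hf.fderiv_right (m := (⊤ : ℕ∞)) (by simp)).differentiable (by simp) x
  have h (z : E3) : fderiv ℝ (fderiv ℝ f) x z w = fderiv ℝ (fun y => fderiv ℝ f y w) x z := by
    rw [fderiv_clm_apply hd (differentiableAt_const w)]; simp
  have h2 (k) : DifferentiableAt ℝ (pd k f) x := (hf.pd k).differentiable (by simp) x
  rw [h, fderiv_apply_eq_sum]
  refine sum_congr rfl fun j _ => ?_
  simp only [fderiv_apply_eq_sum f _ w]
  congr 1
  exact ((HasGrad.sum univ (p := fun k j => w k * pd j (pd k f) x) fun k _ =>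
    (HasGrad.of_diff (h2 k)).const_mul (w k))).2 j

theorem sq_sum_mul_le (v : E3) (w : Fin 3 → ℝ) :
    (∑ l, v l * w l) ^ 2 ≤ ‖v‖ ^ 2 * ∑ l, w l ^ 2 := by
  rw [← sum_sq_coord v]
  exact Finset.sum_mul_sq_le_sq_mul_sq _ _ _

section Vector

variable {V : E3 → E7}

theorem contDiff_component (hV : ContDiff ℝ (⊤ : ℕ∞) V) (i : Fin 7) : ContDiff ℝ (⊤ : ℕ∞) fun y => V y i :=
  (EuclideanSpace.proj (𝕜 := ℝ) i).contDiff.comp hV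

theorem norm_iteratedFDeriv_sq_le (hV : ContDiff ℝ (⊤ : ℕ∞) V) {n : ℕ} {x : E3} {Q : Fin 7 → ℝ}
    (h : ∀ i, ∀ m : Fin n → E3,
      (iteratedFDeriv ℝ n (fun y => V y i) x m) ^ 2 ≤ (∏ l, ‖m l‖) ^ 2 * Q i) :
    ‖iteratedFDeriv ℝ n V x‖ ^ 2 ≤ ∑ i, Q i := by
  have hc (m) (i) : iteratedFDeriv ℝ n (fun y => V y i) x m = iteratedFDeriv ℝ n V x m i := by
    have := (EuclideanSpace.proj (𝕜 := ℝ) i : E7 →L[ℝ] ℝ).iteratedFDeriv_comp_left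
      (f := V) (x := x) (n := (⊤ : ℕ∞)) (i := n) hV.contDiffAt (by exact_mod_cast le_top)
    exact congrArg (fun T => T m) this
  have key (m : Fin n → E3) :
      ‖iteratedFDeriv ℝ n V x m‖ ^ 2 ≤ (∏ l, ‖m l‖) ^ 2 * ∑ i, Q i := by
    rw [EuclideanSpace.norm_sq_eq, Finset.mul_sum]
    refine Finset.sum_le_sum fun i _ => ?_
    rw [← hc, Real.norm_eq_abs, sq_abs]
    exact h i m
  have hQ : 0 ≤ ∑ i, Q i := by
    have h1 := key fun _ => EuclideanSpace.single 0 1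
    simp only [PiLp.norm_single, norm_one, Finset.prod_const_one, one_pow, one_mul] at h1
    exact (sq_nonneg _).trans h1
  refine (Real.le_sqrt (norm_nonneg _) hQ).1
    (ContinuousMultilinearMap.opNorm_le_bound (Real.sqrt_nonneg _) fun m => ?_)
  have hm : 0 ≤ ∏ l, ‖m l‖ := Finset.prod_nonneg fun _ _ => norm_nonneg _
  refine le_of_sq_le_sq ?_ (by positivity)
  rw [mul_pow, Real.sq_sqrt hQ, mul_comm]
  exact key m

theorem norm_iteratedFDeriv_zero_sq_le (hV : ContDiff ℝ (⊤ : ℕ∞) V) (x : E3) :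
    ‖iteratedFDeriv ℝ 0 V x‖ ^ 2 ≤ ∑ i, V x i ^ 2 :=
  norm_iteratedFDeriv_sq_le hV fun i m => by simp

theorem norm_iteratedFDeriv_one_sq_le (hV : ContDiff ℝ (⊤ : ℕ∞) V) (x : E3) :
    ‖iteratedFDeriv ℝ 1 V x‖ ^ 2 ≤ ∑ i, ∑ l, pd l (fun y => V y i) x ^ 2 :=
  norm_iteratedFDeriv_sq_le hV fun i m => by
    rw [iteratedFDeriv_one_apply, fderiv_apply_eq_sum, Fin.prod_univ_one]
    exact sq_sum_mul_le _ _

theorem norm_iteratedFDeriv_two_sq_le (hV : ContDiff ℝ (⊤ : ℕ∞) V) (x : E3) :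
    ‖iteratedFDeriv ℝ 2 V x‖ ^ 2 ≤ ∑ i, hessSq (fun y => V y i) x :=
  norm_iteratedFDeriv_sq_le hV fun i m => by
    rw [iteratedFDeriv_two_apply, fderiv_fderiv_apply_eq_sum (contDiff_component hV i),
      Fin.prod_univ_two, hessSq]
    refine (sq_sum_mul_le _ _).trans ?_
    rw [mul_pow, mul_assoc, Finset.mul_sum (s := univ) (a := ‖m 1‖ ^ 2)]
    gcongr
    exact sq_sum_mul_le _ _

theorem tsupport_component_subset (V : E3 → E7) (i : Fin 7) :
    tsupport (fun y => V y i) ⊆ tsupport V :=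
  closure_mono fun x hx h => hx (by simp [h])

theorem iteratedFDeriv_eq_zero_of_notMem_tsupport {x : E3} (hx : x ∉ tsupport V) (n : ℕ) :
    iteratedFDeriv ℝ n V x = 0 := by
  by_contra h
  exact hx (support_iteratedFDeriv_subset n h)

end Vector

section Weights

variable {τ α : ℝ} {x : E3}

theorem exp_eq_cwt_sq (τ α : ℝ) (x : E3) :
    Real.exp (2 * τ * ‖x‖ ^ (-α)) = cwt τ α 0 x ^ 2 := by
  rw [cwt, Real.rpow_zero, mul_one, ← Real.exp_nat_mul]
  congr 1; push_cast; ring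

theorem weight_zero (hx : x ≠ 0) : ‖x‖ ^ α * ‖x‖ ^ (2 * ((0 : ℝ) - 2) * (1 + α))
    = wt α x ^ 3 * ‖x‖ ^ 2 := by
  have hr : 0 < ‖x‖ := norm_pos_iff.2 hx
  rw [wt, ← Real.rpow_natCast ‖x‖ 2, ← Real.rpow_natCast _ 3, ← Real.rpow_mul hr.le,
    ← Real.rpow_add hr, ← Real.rpow_add hr]
  congr 1; push_cast; ring

theorem weight_one (hx : x ≠ 0) : ‖x‖ ^ α * ‖x‖ ^ (2 * ((1 : ℝ) - 2) * (1 + α)) = wt α x := by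
  have hr : 0 < ‖x‖ := norm_pos_iff.2 hx
  rw [wt, ← Real.rpow_add hr]
  congr 1; ring

end Weights

theorem carlemanEnergy_vector_bound {τ α : ℝ} (hτ : 0 < τ) {r₀ : ℝ} {V : E3 → E7}
    (hV : ContDiff ℝ (⊤ : ℕ∞) V) (hs : tsupport V ⊆ ball (0 : E3) r₀ \ {0}) :
    (∑ j ∈ Finset.range 3, τ ^ ((3 : ℤ) - 2 * j)
            * ∫ x : E3, Real.exp (2 * τ * ‖x‖ ^ (-α)) * ‖x‖ ^ α
                * ‖x‖ ^ (2 * ((j : ℝ) - 2) * (1 + α)) * ‖iteratedFDeriv ℝ j V x‖ ^ 2)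
      ≤ ∑ i, (2 * (∫ x, carlemanEnergy τ α (fun y => V y i) x)
        + τ⁻¹ * ∫ x, cwt τ α (α / 2) x ^ 2 * hessSq (fun y => V y i) x) := by
  have hc := contDiff_component hV
  have hsc (i) := (tsupport_component_subset V i).trans hs
  have iE (i) := integrable_carlemanEnergy (α := α) τ (hc i) (hsc i)
  have iH (i) := integrable_cwt_hessSq τ α (hc i) (hsc i)
  have hE (i x) := carlemanEnergy_nonneg hτ.le α (fun y => V y i) x
  have hS (i x) : 0 ≤ ∑ l, pd l (fun y => V y i) x ^ 2 := Finset.sum_nonneg fun _ _ => sq_nonneg _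
  have main (j : ℕ) (F : E3 → ℝ) (hF0 : ∀ x, 0 ≤ F x) (hF : Integrable F)
      (h : ∀ x ≠ 0, τ ^ ((3 : ℤ) - 2 * j) * (cwt τ α 0 x ^ 2 * (‖x‖ ^ α
                * ‖x‖ ^ (2 * ((j : ℝ) - 2) * (1 + α)) * ‖iteratedFDeriv ℝ j V x‖ ^ 2)) ≤ F x) :
      τ ^ ((3 : ℤ) - 2 * j) * (∫ x : E3, Real.exp (2 * τ * ‖x‖ ^ (-α)) * ‖x‖ ^ α
        * ‖x‖ ^ (2 * ((j : ℝ) - 2) * (1 + α)) * ‖iteratedFDeriv ℝ j V x‖ ^ 2) ≤ ∫ x, F x := by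
    rw [← integral_const_mul]
    refine integral_mono_of_nonneg (ae_of_all _ fun x => ?_) hF (ae_of_all _ fun x => ?_)
    · change 0 ≤ _
      positivity
    · by_cases hx : x ∈ tsupport V
      · refine le_trans (le_of_eq ?_) (h x (hs hx).2)
        simp only [exp_eq_cwt_sq]; ring
      · simp only [iteratedFDeriv_eq_zero_of_notMem_tsupport hx]
        simpa using hF0 x
  have m0 := main 0 (fun x => ∑ i, carlemanEnergy τ α (fun y => V y i) x)
    (fun x => Finset.sum_nonneg fun i _ => hE i x) (integrable_finsetSum _ fun i _ => iE i)
    fun x hx => by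
      have h := norm_iteratedFDeriv_zero_sq_le hV x
      have hW := wt_nonneg α x
      push_cast
      rw [weight_zero hx]
      calc _ ≤ τ ^ 3 * (cwt τ α 0 x ^ 2 * (wt α x ^ 3 * ‖x‖ ^ 2 * ∑ i, V x i ^ 2)) := by
            norm_num; norm_num at h; gcongr
        _ ≤ _ := by
            simp only [Finset.mul_sum]
            refine Finset.sum_le_sum fun i _ => ?_
            have : 0 ≤ cwt τ α 0 x ^ 2 * (τ * wt α x * ∑ l, pd l (fun y => V y i) x ^ 2) :=
              mul_nonneg (sq_nonneg _) (mul_nonneg (by positivity) (hS i x))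
            rw [carlemanEnergy]; linarith
  have m1 := main 1 (fun x => ∑ i, carlemanEnergy τ α (fun y => V y i) x)
    (fun x => Finset.sum_nonneg fun i _ => hE i x) (integrable_finsetSum _ fun i _ => iE i)
    fun x hx => by
      have h := norm_iteratedFDeriv_one_sq_le hV x
      have hW := wt_nonneg α x
      push_cast
      rw [weight_one hx]
      calc _ ≤ τ * (cwt τ α 0 x ^ 2 * (wt α x
            * ∑ i, ∑ l, pd l (fun y => V y i) x ^ 2)) := by
            norm_num; norm_num at h; gcongr
        _ ≤ _ := by
            rw [Finset.mul_sum, Finset.mul_sum, Finset.mul_sum]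
            refine Finset.sum_le_sum fun i _ => ?_
            have : 0 ≤ cwt τ α 0 x ^ 2 * (τ ^ 3 * wt α x ^ 3 * ‖x‖ ^ 2 * V x i ^ 2) := by
              positivity
            rw [carlemanEnergy]; linarith
  have m2 := main 2 (fun x => ∑ i, τ⁻¹ * (cwt τ α (α / 2) x ^ 2 * hessSq (fun y => V y i) x))
    (fun x => Finset.sum_nonneg fun i _ => mul_nonneg (by positivity)
      (mul_nonneg (sq_nonneg _) (hessSq_nonneg _ _)))
    (integrable_finsetSum _ fun i _ => (iH i).const_mul _)
    fun x hx => by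
      have h := norm_iteratedFDeriv_two_sq_le hV x
      push_cast
      rw [← Finset.mul_sum, ← Finset.mul_sum, cwt_sq_eq hx]
      norm_num [zpow_neg]
      rw [mul_assoc (cwt τ α 0 x ^ 2)]
      gcongr
  rw [integral_finsetSum _ fun i _ => iE i] at m0 m1
  rw [integral_finsetSum _ fun i _ => (iH i).const_mul _] at m2
  simp only [integral_const_mul] at m2
  rw [Finset.sum_range_succ, Finset.sum_range_succ, Finset.sum_range_one, Finset.sum_add_distrib,
    ← Finset.mul_sum]
  exact (add_le_add (add_le_add m0 m1) m2).trans_eq (by ring)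

/-- **Stronger Carleman estimate for the second-order operators** (Section 4.2).
Under the hypotheses of Proposition 4.2, for `τ > τ₀` and smooth `V` compactly
supported in `B(0,r₀) \ {0}`:
`Σ_{j=0}^{2} τ^{3-2j} ∫ e^{2τ|x|^{-α}} |x|^α |x|^{2(j-2)(1+α)} |D^j V|²
  ≤ C ∫ e^{2τ|x|^{-α}} |P_ℓ V|²`. -/
theorem carleman_second_order_strong
    (Ω : Set E3) (hΩopen : IsOpen Ω) (h0Ω : (0 : E3) ∈ Ω)
    (s α : ℝ) (hs : 1 ≤ s) (hα : 0 < α) (hsα : s < 1 + 1 / α)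
    (a : Fin 2 → Fin 3 → Fin 3 → E3 → ℝ)
    (hsym : ∀ ℓ : Fin 2, ∀ j k : Fin 3, ∀ x : E3, a ℓ j k x = a ℓ k j x)
    (hG : ∀ ℓ : Fin 2, ∀ j k : Fin 3, GevreyOn s Ω (a ℓ j k))
    (hell : ∀ ℓ : Fin 2, UnifElliptic (a ℓ) Ω)
    (heig : ∀ ℓ : Fin 2, EigCond (a ℓ) α) :
    ∃ τ0 > (0 : ℝ), ∃ r0 > (0 : ℝ), ∃ C > (0 : ℝ), ∀ τ : ℝ, τ > τ0 → ∀ ℓ : Fin 2,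
      ∀ V : E3 → E7, ContDiff ℝ (⊤ : ℕ∞) V → tsupport V ⊆ ball (0 : E3) r0 \ {0} →
        (∑ j ∈ Finset.range 3, τ ^ ((3 : ℤ) - 2 * j)
            * ∫ x : E3, Real.exp (2 * τ * ‖x‖ ^ (-α)) * ‖x‖ ^ α
                * ‖x‖ ^ (2 * ((j : ℝ) - 2) * (1 + α)) * ‖iteratedFDeriv ℝ j V x‖ ^ 2)
        ≤ C * ∫ x : E3, Real.exp (2 * τ * ‖x‖ ^ (-α))
              * (∑ i, (op2 (a ℓ) (fun y => V y i) x) ^ 2) := by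
  choose τ₀ hτ₀ r₀ hr₀ C hC h using fun ℓ =>
    exists_carleman_scalar hΩopen h0Ω hα (hsym ℓ) (hG ℓ) (hell ℓ) (heig ℓ)
  refine ⟨max (τ₀ 0) (τ₀ 1), lt_max_of_lt_left (one_pos.trans_le (hτ₀ 0)), min (r₀ 0) (r₀ 1),
    lt_min (hr₀ 0) (hr₀ 1), 2 * (C 0 + C 1), by linarith [hC 0, hC 1], fun τ hτ ℓ V hV hV0 => ?_⟩
  have hτℓ : τ₀ ℓ < τ := by
    fin_cases ℓ
    exacts [(le_max_left _ _).trans_lt hτ, (le_max_right _ _).trans_lt hτ]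
  have hrℓ : min (r₀ 0) (r₀ 1) ≤ r₀ ℓ := by
    fin_cases ℓ
    exacts [min_le_left _ _, min_le_right _ _]
  have hCℓ : C ℓ ≤ C 0 + C 1 := by
    fin_cases ℓ
    exacts [le_add_of_nonneg_right (hC 1).le, le_add_of_nonneg_left (hC 0).le]
  have hτ0 : 0 < τ := (one_pos.trans_le (hτ₀ ℓ)).trans hτℓ
  have key (i : Fin 7) := h ℓ τ hτℓ (fun y => V y i) (contDiff_component hV i)
    (((tsupport_component_subset V i).trans hV0).trans
      (Set.sdiff_subset_sdiff_left (ball_subset_ball hrℓ)))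
  have hR : (∫ x : E3, Real.exp (2 * τ * ‖x‖ ^ (-α)) * ∑ i, op2 (a ℓ) (fun y => V y i) x ^ 2)
      = ∑ i, ∫ x, (cwt τ α 0 x * op2 (a ℓ) (fun y => V y i) x) ^ 2 := by
    rw [← integral_finsetSum _ fun i _ => (key i).1]
    simp only [exp_eq_cwt_sq, Finset.mul_sum, mul_pow]
  rw [hR, Finset.mul_sum]
  refine (carlemanEnergy_vector_bound hτ0 hV hV0).trans (Finset.sum_le_sum fun i _ => ?_)
  have hH : 0 ≤ τ⁻¹ * ∫ x, cwt τ α (α / 2) x ^ 2 * hessSq (fun y => V y i) x :=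
    mul_nonneg (by positivity)
      (integral_nonneg fun x => mul_nonneg (sq_nonneg _) (hessSq_nonneg _ _))
  have hI : 0 ≤ ∫ x, (cwt τ α 0 x * op2 (a ℓ) (fun y => V y i) x) ^ 2 :=
    integral_nonneg fun x => sq_nonneg _
  have := mul_le_mul_of_nonneg_right hCℓ hI
  linarith [(key i).2]
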